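/- arXiv:1802.07394 — 4 statements merged into one kernel-verified Lean document; each statement's English description precedes it below -/
import Mathlib

section
/- Let A, B ∈ M₄(ℂ) be Hermitian matrices and suppose A has a repeated eigenvalue, i.e., there exists μ ∈ ℝ with dim(ker(A − μI₄)) ≥ 2. Then the operator system 𝒱 = span_ℂ(I₄, A, B) has a quantum 2-anticlique. -/
open Matrix

/-- An operator system: a subspace of matrices containing the identity and
closed under conjugate transpose. -/
def IsOperatorSystem {ι : Type*} [Fintype ι] [DecidableEq ι]
    (V : Submodule ℂ (Matrix ι ι ℂ)) : Prop :=
  (1 : Matrix ι ι ℂ) ∈ V ∧ ∀ A ∈ V, Aᴴ ∈ V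

/-- An orthogonal projection: `P = P² = P*`. -/
def IsOrthogonalProjection {ι : Type*} [Fintype ι] [DecidableEq ι]
    (P : Matrix ι ι ℂ) : Prop :=
  P * P = P ∧ Pᴴ = P

/-- The compression `PVP = {PAP : A ∈ V}`. -/
noncomputable def compress {ι : Type*} [Fintype ι] [DecidableEq ι]
    (P : Matrix ι ι ℂ) (V : Submodule ℂ (Matrix ι ι ℂ)) :
    Submodule ℂ (Matrix ι ι ℂ) :=
  V.map ((LinearMap.mulLeft ℂ P).comp (LinearMap.mulRight ℂ P))

/-- `V` has a quantum `k`-anticlique: a rank-`k` orthogonal projection `P`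
with `dim (PVP) = 1`. -/
def HasQuantumAnticlique {ι : Type*} [Fintype ι] [DecidableEq ι]
    (V : Submodule ℂ (Matrix ι ι ℂ)) (k : ℕ) : Prop :=
  ∃ P : Matrix ι ι ℂ, IsOrthogonalProjection P ∧ P.rank = k ∧
    Module.finrank ℂ (compress P V) = 1

/-- `V` has a quantum `k`-clique: a rank-`k` orthogonal projection `P`
with `dim (PVP) = k²`. -/
def HasQuantumClique {ι : Type*} [Fintype ι] [DecidableEq ι]
    (V : Submodule ℂ (Matrix ι ι ℂ)) (k : ℕ) : Prop :=
  ∃ P : Matrix ι ι ℂ, IsOrthogonalProjection P ∧ P.rank = k ∧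
    Module.finrank ℂ (compress P V) = k ^ 2

open Module

section QuadraticValues

variable {E : Type*} [NormedAddCommGroup E] [InnerProductSpace ℂ E]

/-- The real part of the quadratic form `v ↦ ⟪v, T v⟫`. -/
noncomputable def quadValue (T : E →ₗ[ℂ] E) (v : E) : ℝ :=
  (inner ℂ v (T v)).re

theorem LinearMap.IsSymmetric.inner_self_eq_quadValue {T : E →ₗ[ℂ] E} (hT : T.IsSymmetric)
    (v : E) : inner ℂ v (T v) = (quadValue T v : ℂ) := by
  apply Complex.ext
  · simp [quadValue]
  · have h := hT v v
    have h2 := inner_conj_symm (𝕜 := ℂ) v (T v)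
    rw [h] at h2
    simpa using Complex.conj_eq_iff_im.1 h2

theorem quadValue_smul (T : E →ₗ[ℂ] E) (c : ℂ) (v : E) :
    quadValue T (c • v) = ‖c‖ ^ 2 * quadValue T v := by
  simp only [quadValue, map_smul, inner_smul_left, inner_smul_right, ← mul_assoc]
  rw [Complex.mul_conj, Complex.normSq_eq_norm_sq, Complex.re_ofReal_mul]

theorem quadValue_add {T : E →ₗ[ℂ] E} (hT : T.IsSymmetric) (u v : E) :
    quadValue T (u + v) = quadValue T u + 2 * (inner ℂ u (T v)).re + quadValue T v := by
  have h : (inner ℂ v (T u)).re = (inner ℂ u (T v)).re := by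
    rw [← hT v u, ← inner_conj_symm (𝕜 := ℂ) (T v) u, Complex.conj_re]
  simp only [quadValue, map_add, inner_add_left, inner_add_right, Complex.add_re, h]
  ring

theorem quadValue_neg (T : E →ₗ[ℂ] E) (v : E) : quadValue (-T) v = -quadValue T v := by
  simp [quadValue]

theorem quadValue_combination (A B : E →ₗ[ℂ] E) (x y : ℝ) (v : E) :
    quadValue ((x : ℂ) • A + (y : ℂ) • B) v = x * quadValue A v + y * quadValue B v := by
  simp [quadValue]

theorem quadValue_sub_scalar (A : E →ₗ[ℂ] E) (c : ℝ) (v : E) :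
    quadValue (A - (c : ℂ) • LinearMap.id) v = quadValue A v - c * ‖v‖ ^ 2 := by
  simp only [quadValue, LinearMap.sub_apply, LinearMap.smul_apply, LinearMap.id_apply,
    inner_sub_right, inner_smul_right, Complex.sub_re, inner_self_eq_norm_sq_to_K,
    Complex.re_ofReal_mul]
  norm_cast

theorem LinearMap.IsSymmetric.real_combination {A B : E →ₗ[ℂ] E} (hA : A.IsSymmetric)
    (hB : B.IsSymmetric) (x y : ℝ) : ((x : ℂ) • A + (y : ℂ) • B).IsSymmetric :=
  (hA.smul (Complex.conj_ofReal x)).add (hB.smul (Complex.conj_ofReal y))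

theorem LinearMap.IsSymmetric.sub_scalar {A : E →ₗ[ℂ] E} (hA : A.IsSymmetric) (c : ℝ) :
    (A - (c : ℂ) • LinearMap.id).IsSymmetric :=
  hA.sub (LinearMap.IsSymmetric.id.smul (Complex.conj_ofReal c))

/-- Polarization on a subspace. -/
theorem inner_eq_zero_of_quadValue_eq_zero {T : E →ₗ[ℂ] E} (hT : T.IsSymmetric)
    {S : Submodule ℂ E} (h : ∀ u ∈ S, quadValue T u = 0) {u w : E} (hu : u ∈ S) (hw : w ∈ S) :
    inner ℂ u (T w) = 0 := by
  apply Complex.ext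
  · have h1 := quadValue_add hT u w
    rw [h _ (S.add_mem hu hw), h _ hu, h _ hw] at h1
    simp; linarith
  · have hw' := S.smul_mem Complex.I hw
    have h1 := quadValue_add hT u (Complex.I • w)
    rw [h _ (S.add_mem hu hw'), h _ hu, h _ hw', map_smul, inner_smul_right] at h1
    simp at h1
    simp; linarith

/-- If `T ≤ 0` on `S` then null vectors of `S` are `T`-orthogonal to `S`. -/
theorem inner_eq_zero_of_quadValue_nonpos {T : E →ₗ[ℂ] E} (hT : T.IsSymmetric)
    {S : Submodule ℂ E} (h : ∀ u ∈ S, quadValue T u ≤ 0) {u w : E} (hu : u ∈ S)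
    (hu0 : quadValue T u = 0) (hw : w ∈ S) : inner ℂ w (T u) = 0 := by
  by_contra hne
  set z := inner ℂ w (T u) with hz
  have hpos : 0 < ‖z‖ ^ 2 := by positivity
  have key : ∀ t : ℝ, t * (2 * ‖z‖ ^ 2) + quadValue T w ≤ 0 := by
    intro t
    have h1 := quadValue_add hT w (((t : ℂ) * (starRingEnd ℂ) z) • u)
    rw [quadValue_smul, hu0, map_smul, inner_smul_right, ← hz] at h1
    have h2 : ((t : ℂ) * (starRingEnd ℂ) z * z).re = t * ‖z‖ ^ 2 := by
      rw [mul_assoc, mul_comm _ z, Complex.mul_conj, Complex.normSq_eq_norm_sq]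
      norm_cast
    rw [h2] at h1
    have := h _ (S.add_mem hw (S.smul_mem ((t : ℂ) * (starRingEnd ℂ) z) hu))
    linarith
  have := key ((1 - quadValue T w) / (2 * ‖z‖ ^ 2))
  rw [div_mul_cancel₀ _ (by positivity)] at this
  linarith

end QuadraticValues

section Dimension

variable {E : Type*} [AddCommGroup E] [Module ℂ E] [FiniteDimensional ℂ E]

theorem finrank_add_le_finrank_inf_add (S T : Submodule ℂ E) :
    finrank ℂ S + finrank ℂ T ≤ finrank ℂ (S ⊓ T : Submodule ℂ E) + finrank ℂ E := by
  have := Submodule.finrank_sup_add_finrank_inf_eq S T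
  have := Submodule.finrank_le (S ⊔ T)
  omega

theorem exists_mem_inf_ne_zero {S T : Submodule ℂ E}
    (h : finrank ℂ E < finrank ℂ S + finrank ℂ T) : ∃ v, v ∈ S ∧ v ∈ T ∧ v ≠ 0 := by
  have := finrank_add_le_finrank_inf_add S T
  have hne : (S ⊓ T : Submodule ℂ E) ≠ ⊥ := by
    intro h0
    rw [h0, finrank_bot] at this
    omega
  obtain ⟨v, hv, hv0⟩ := Submodule.exists_mem_ne_zero_of_ne_bot hne
  exact ⟨v, hv.1, hv.2, hv0⟩

theorem finrank_lt_finrank_sup_span {S : Submodule ℂ E} {x : E} (hx : x ∉ S) :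
    finrank ℂ S < finrank ℂ (S ⊔ Submodule.span ℂ {x} : Submodule ℂ E) := by
  apply Submodule.finrank_lt_finrank_of_lt
  refine lt_of_le_of_ne le_sup_left fun h => hx ?_
  rw [h]
  exact Submodule.mem_sup_right (Submodule.mem_span_singleton_self x)

end Dimension

section Spectral

variable {E : Type*} [NormedAddCommGroup E] [InnerProductSpace ℂ E] [FiniteDimensional ℂ E]

theorem exists_spectral_splitting {T : E →ₗ[ℂ] E} (hT : T.IsSymmetric) {n k l : ℕ}
    (hn : finrank ℂ E = n) (hk : 1 ≤ k) (hkl : k + l = n + 1) (hl : 1 ≤ l) :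
    ∃ (r : ℝ) (U S : Submodule ℂ E), finrank ℂ U = k ∧ finrank ℂ S = l ∧
      (∀ v ∈ U, r * ‖v‖ ^ 2 ≤ quadValue T v) ∧ (∀ v ∈ S, quadValue T v ≤ r * ‖v‖ ^ 2) ∧
      (∀ v ∈ S, quadValue T v = r * ‖v‖ ^ 2 → T v = (r : ℂ) • v) := by
  classical
  let e := hT.eigenvectorBasis hn
  let ev := hT.eigenvalues hn
  have anti : Antitone ev := hT.eigenvalues_antitone hn
  let i₀ : Fin n := ⟨k - 1, by omega⟩
  have hval : ∀ v, quadValue T v = ∑ i, ev i * ‖e.repr v i‖ ^ 2 := by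
    intro v
    rw [quadValue, ← e.repr.inner_map_map, PiLp.inner_apply, Complex.re_sum]
    refine Finset.sum_congr rfl fun i _ => ?_
    rw [hT.eigenvectorBasis_apply_self_apply hn v i]
    change (inner ℂ (e.repr v i) ((ev i : ℂ) * e.repr v i)).re = _
    rw [← smul_eq_mul, inner_smul_right, inner_self_eq_norm_sq_to_K,
      Complex.re_ofReal_mul]
    norm_cast
  have hnorm : ∀ v, ‖v‖ ^ 2 = ∑ i, ‖e.repr v i‖ ^ 2 := by
    intro v
    rw [← e.repr.norm_map, EuclideanSpace.norm_sq_eq]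
  have hcard : ∀ s : Finset (Fin n),
      finrank ℂ (Submodule.span ℂ (Set.range fun i : s => e i)) = s.card := by
    intro s
    have hli : LinearIndependent ℂ (fun i : s => e i) :=
      e.orthonormal.linearIndependent.comp (fun i : s => (i : Fin n)) Subtype.val_injective
    rw [finrank_span_eq_card hli, Fintype.card_coe]
  have hcoord : ∀ (s : Finset (Fin n)), ∀ v ∈ Submodule.span ℂ (Set.range fun i : s => e i),
      ∀ j ∉ s, e.repr v j = 0 := by
    intro s v hv j hj
    induction hv using Submodule.span_induction with
    | mem x hx =>
      obtain ⟨i, rfl⟩ := hx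
      have hij : j ≠ i := fun h => hj (h ▸ i.2)
      simp [hij]
    | zero => simp
    | add x y _ _ hx hy => simp [hx, hy]
    | smul c x _ hx => simp [hx]
  refine ⟨ev i₀, _, _, (hcard (Finset.Iic i₀)).trans ?_, (hcard (Finset.Ici i₀)).trans ?_,
    ?_, ?_, ?_⟩
  · simp [i₀]; omega
  · simp [i₀]; omega
  · intro v hv
    rw [hval, hnorm, Finset.mul_sum]
    refine Finset.sum_le_sum fun i _ => ?_
    by_cases hi : i ∈ Finset.Iic i₀
    · exact mul_le_mul_of_nonneg_right (anti (Finset.mem_Iic.1 hi)) (by positivity)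
    · simp [hcoord _ v hv i hi]
  · intro v hv
    rw [hval, hnorm, Finset.mul_sum]
    refine Finset.sum_le_sum fun i _ => ?_
    by_cases hi : i ∈ Finset.Ici i₀
    · exact mul_le_mul_of_nonneg_right (anti (Finset.mem_Ici.1 hi)) (by positivity)
    · simp [hcoord _ v hv i hi]
  · intro v hv heq
    rw [hval, hnorm, Finset.mul_sum] at heq
    have hle : ∀ i ∈ Finset.univ, ev i * ‖e.repr v i‖ ^ 2 ≤ ev i₀ * ‖e.repr v i‖ ^ 2 := by
      intro i _
      by_cases hi : i ∈ Finset.Ici i₀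
      · exact mul_le_mul_of_nonneg_right (anti (Finset.mem_Ici.1 hi)) (by positivity)
      · simp [hcoord _ v hv i hi]
    have hall := (Finset.sum_eq_sum_iff_of_le hle).1 heq
    apply e.repr.injective
    ext i
    rw [hT.eigenvectorBasis_apply_self_apply hn v i, map_smul]
    change (ev i : ℂ) * e.repr v i = (ev i₀ : ℂ) * e.repr v i
    have hi := hall i (Finset.mem_univ i)
    by_cases h0 : e.repr v i = 0
    · simp [h0]
    · have : ‖e.repr v i‖ ^ 2 ≠ 0 := by positivity
      rw [mul_right_cancel₀ this hi]

end Spectral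

section IsotropicSubspaces

variable {E : Type*} [NormedAddCommGroup E] [InnerProductSpace ℂ E] [FiniteDimensional ℂ E]

theorem continuous_quadValue (T : E →ₗ[ℂ] E) : Continuous (quadValue T) := by
  have := T.continuous_of_finiteDimensional
  unfold quadValue
  fun_prop

/-- If a form is nonpositive on one subspace of codimension at most one and nonnegative on
another, it vanishes on some subspace of codimension at most one. -/
theorem exists_isotropic_of_codim_one {T : E →ₗ[ℂ] E} (hT : T.IsSymmetric) {m : ℕ}
    (hE : finrank ℂ E = m + 1) {S U : Submodule ℂ E} (hS : m ≤ finrank ℂ S)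
    (hU : m ≤ finrank ℂ U) (hSn : ∀ v ∈ S, quadValue T v ≤ 0)
    (hUp : ∀ v ∈ U, 0 ≤ quadValue T v) :
    ∃ W : Submodule ℂ E, m ≤ finrank ℂ W ∧ ∀ v ∈ W, quadValue T v = 0 := by
  by_cases h1 : S ≤ U
  · exact ⟨S, hS, fun v hv => le_antisymm (hSn v hv) (hUp v (h1 hv))⟩
  by_cases h2 : U ≤ S
  · exact ⟨U, hU, fun v hv => le_antisymm (hSn v (h2 hv)) (hUp v hv)⟩
  obtain ⟨s, hsS, hsU⟩ := SetLike.not_le_iff_exists.1 h1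
  obtain ⟨u, huU, huS⟩ := SetLike.not_le_iff_exists.1 h2
  have htop : S ⊔ U = ⊤ := by
    apply Submodule.eq_top_of_finrank_eq
    have hlt : S < S ⊔ U := lt_of_le_of_ne le_sup_left
      fun h => huS (h ▸ Submodule.mem_sup_right huU)
    have := Submodule.finrank_lt_finrank_of_lt hlt
    have := Submodule.finrank_le (S ⊔ U)
    omega
  have hker : ∀ v ∈ S ⊓ U, T v = 0 := by
    rintro v ⟨hvS, hvU⟩
    have hv0 : quadValue T v = 0 := le_antisymm (hSn v hvS) (hUp v hvU)
    have hneg : ∀ w ∈ U, quadValue (-T) w ≤ 0 := fun w hw => by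
      rw [quadValue_neg]; linarith [hUp w hw]
    have hT' : (-T).IsSymmetric := fun x y => by simp [hT x y]
    have horth : ∀ w, inner ℂ w (T v) = 0 := by
      intro w
      obtain ⟨a, ha, b, hb, rfl⟩ := Submodule.mem_sup.1 (htop ▸ Submodule.mem_top : w ∈ S ⊔ U)
      have hb0 := inner_eq_zero_of_quadValue_nonpos hT' hneg hvU
        (by rw [quadValue_neg, hv0, neg_zero]) hb
      rw [LinearMap.neg_apply, inner_neg_right, neg_eq_zero] at hb0
      rw [inner_add_left, inner_eq_zero_of_quadValue_nonpos hT hSn hvS hv0 ha, hb0, add_zero]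
    exact inner_self_eq_zero.1 (horth (T v))
  obtain ⟨t, -, ht⟩ : ∃ t ∈ Set.Icc (0 : ℝ) 1,
      quadValue T (((1 - t : ℝ) : ℂ) • s + (t : ℂ) • u) = 0 := by
    have hcont : ContinuousOn (fun t : ℝ => quadValue T (((1 - t : ℝ) : ℂ) • s + (t : ℂ) • u))
        (Set.Icc 0 1) := by
      have := continuous_quadValue T
      fun_prop
    refine intermediate_value_Icc zero_le_one hcont ⟨?_, ?_⟩
    · simpa using hSn s hsS
    · simpa using hUp u huU
  set x := ((1 - t : ℝ) : ℂ) • s + (t : ℂ) • u with hx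
  have hxN : x ∉ S ⊓ U := by
    rintro ⟨hxS, hxU⟩
    by_cases ht0 : t = 0
    · exact hsU (by simpa [hx, ht0] using hxU)
    · have : (t : ℂ) • u ∈ S := (Submodule.add_mem_iff_right S (S.smul_mem _ hsS)).1 hxS
      exact huS ((Submodule.smul_mem_iff S (by exact_mod_cast ht0)).1 this)
  refine ⟨S ⊓ U ⊔ Submodule.span ℂ {x}, ?_, ?_⟩
  · have := finrank_lt_finrank_sup_span hxN
    have := finrank_add_le_finrank_inf_add S U
    omega
  · intro v hv
    obtain ⟨a, ha, b, hb, rfl⟩ := Submodule.mem_sup.1 hv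
    obtain ⟨c, rfl⟩ := Submodule.mem_span_singleton.1 hb
    have h0 : quadValue T a = 0 := by simp [quadValue, hker a ha]
    rw [add_comm, quadValue_add hT, quadValue_smul, ht, hker a ha, h0]
    simp

omit [FiniteDimensional ℂ E] in
theorem exists_submodule_le_finrank_eq (W : Submodule ℂ E) {k : ℕ} (hk : k ≤ finrank ℂ W) :
    ∃ S ≤ W, finrank ℂ S = k := by
  obtain ⟨f, hf⟩ := exists_linearIndependent_of_le_finrank hk
  refine ⟨Submodule.span ℂ (Set.range fun i => (f i : E)), ?_, ?_⟩
  · rw [Submodule.span_le]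
    rintro _ ⟨i, rfl⟩
    exact (f i).2
  · have hf' : LinearIndependent ℂ fun i => (f i : E) := hf.map' W.subtype W.ker_subtype
    rw [finrank_span_eq_card hf', Fintype.card_fin]

/-- A symmetric operator has scalar compression to a plane inside any three-dimensional
subspace. -/
theorem exists_plane_quadValue_eq {B : E →ₗ[ℂ] E} (hB : B.IsSymmetric) (W : Submodule ℂ E)
    (hW : 3 ≤ finrank ℂ W) :
    ∃ (r : ℝ) (S : Submodule ℂ E), S ≤ W ∧ 2 ≤ finrank ℂ S ∧
      ∀ v ∈ S, quadValue B v = r * ‖v‖ ^ 2 := by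
  obtain ⟨V, hVW, hV⟩ := exists_submodule_le_finrank_eq W hW
  let C : V →ₗ[ℂ] V := V.orthogonalProjectionOnto.toLinearMap ∘ₗ B ∘ₗ V.subtype
  have hCin : ∀ u v : V, inner ℂ u (C v) = inner ℂ (u : E) (B v) := by
    intro u v
    rw [Submodule.coe_inner]
    exact (Submodule.inner_orthogonalProjectionOnto_eq_of_mem_left u (B v))
  have hC : C.IsSymmetric := by
    intro u v
    rw [hCin, ← inner_conj_symm, hCin, inner_conj_symm, hB]
  have hq : ∀ v : V, quadValue C v = quadValue B (v : E) := fun v => by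
    rw [quadValue, hCin, quadValue]
  obtain ⟨r, U, S, hU, hS, hUr, hSr, -⟩ :=
    exists_spectral_splitting hC (k := 2) (l := 2) hV (by omega) (by omega) (by omega)
  obtain ⟨N, hN, hN0⟩ := exists_isotropic_of_codim_one (hC.sub_scalar r) (m := 2) hV hS.ge hU.ge
    (fun v hv => by rw [quadValue_sub_scalar]; linarith [hSr v hv])
    (fun v hv => by rw [quadValue_sub_scalar]; linarith [hUr v hv])
  refine ⟨r, N.map V.subtype, (Submodule.map_subtype_le V N).trans hVW, ?_, ?_⟩
  · rwa [Submodule.finrank_map_subtype_eq]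
  · rintro _ ⟨v, hv, rfl⟩
    have := hN0 v hv
    rw [quadValue_sub_scalar, hq] at this
    change quadValue B (v : E) = r * ‖(v : E)‖ ^ 2
    have hn : ‖v‖ = ‖(v : E)‖ := rfl
    rw [← hn]
    linarith

end IsotropicSubspaces

section NumericalRange

variable {E : Type*} [NormedAddCommGroup E] [InnerProductSpace ℂ E]

/-- Toeplitz–Hausdorff: the numerical range of an operator over a subspace is convex. -/
theorem convex_numericalRange (C : E →ₗ[ℂ] E) (F : Submodule ℂ E) :
    Convex ℝ {z : ℂ | ∃ u ∈ F, ‖u‖ = 1 ∧ inner ℂ u (C u) = z} := by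
  rintro p ⟨u, huF, hu1, hup⟩ r ⟨w, hwF, hw1, hwr⟩ a b ha hb hab
  by_cases hpr : p = r
  · refine ⟨u, huF, hu1, ?_⟩
    rw [hup, ← hpr, ← add_smul, hab, one_smul]
  have hd : r - p ≠ 0 := sub_ne_zero.2 (Ne.symm hpr)
  have hscalar : ∀ (e : ℂ), inner ℂ (e • u) (C (e • u)) = p * ‖e‖ ^ 2 := by
    intro e
    rw [map_smul, inner_smul_left, inner_smul_right, hup, ← mul_assoc, mul_comm _ e,
      Complex.mul_conj, Complex.normSq_eq_norm_sq]
    push_cast; ring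
  let D : E →ₗ[ℂ] E := (r - p)⁻¹ • (C - p • LinearMap.id)
  have hD : ∀ x y, inner ℂ x (D y) = (r - p)⁻¹ * (inner ℂ x (C y) - p * inner ℂ x y) := by
    intro x y
    simp [D]
  have hDu : inner ℂ u (D u) = 0 := by
    rw [hD, hup, inner_self_eq_norm_sq_to_K, hu1]; simp
  have hDw : inner ℂ w (D w) = 1 := by
    rw [hD, hwr, inner_self_eq_norm_sq_to_K, hw1]; simp [hd]
  set α := inner ℂ u (D w) with hα
  set β := inner ℂ w (D u) with hβ
  obtain ⟨e, he1, he⟩ : ∃ e : ℂ, ‖e‖ = 1 ∧ ((starRingEnd ℂ) e * α + e * β).im = 0 := by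
    by_cases h0 : β - (starRingEnd ℂ) α = 0
    · refine ⟨1, by simp, ?_⟩
      rw [sub_eq_zero.1 h0]; simp
    · refine ⟨(starRingEnd ℂ) (β - (starRingEnd ℂ) α) / ‖β - (starRingEnd ℂ) α‖, ?_, ?_⟩
      · rw [norm_div, RCLike.norm_conj, Complex.norm_real, norm_norm, div_self]
        exact norm_ne_zero_iff.2 h0
      · have hn : (‖β - (starRingEnd ℂ) α‖ : ℂ) ≠ 0 := by exact_mod_cast norm_ne_zero_iff.2 h0
        have : ∀ (e : ℂ), ((starRingEnd ℂ) e * α + e * β).im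
            = (e * (β - (starRingEnd ℂ) α)).im := by
          intro e; simp; ring
        rw [this, div_mul_eq_mul_div, mul_comm, Complex.mul_conj, ← Complex.ofReal_div,
          Complex.ofReal_im]
  let z : ℝ → E := fun s => ((1 - s : ℝ) : ℂ) • (e • u) + (s : ℂ) • w
  have hz : ∀ s, inner ℂ (z s) (D (z s)) =
      ((s ^ 2 + s * (1 - s) * ((starRingEnd ℂ) e * α + e * β).re : ℝ) : ℂ) := by
    intro s
    have hre : ((((starRingEnd ℂ) e * α + e * β).re : ℝ) : ℂ) = (starRingEnd ℂ) e * α + e * β := by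
      apply Complex.ext
      · simp
      · rw [he]; simp
    push_cast
    rw [hre]
    simp only [z, map_add, map_smul, inner_add_left, inner_add_right, inner_smul_left,
      inner_smul_right, hDu, hDw, Complex.conj_ofReal, ← hα, ← hβ]
    push_cast
    ring
  have hz0 : ∀ s, z s ≠ 0 := by
    intro s hs
    by_cases hs0 : s = 0
    · have : e • u = 0 := by simpa [z, hs0] using hs
      have hnorm : ‖e • u‖ = 1 := by rw [norm_smul, he1, hu1, one_mul]
      rw [this, norm_zero] at hnorm
      exact zero_ne_one hnorm
    · have hsc : (s : ℂ) ≠ 0 := by exact_mod_cast hs0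
      have hw : w = (-(s : ℂ)⁻¹ * ((1 - s : ℝ) : ℂ) * e) • u := by
        have h1 : (s : ℂ) • w = -(((1 - s : ℝ) : ℂ) • (e • u)) :=
          eq_neg_of_add_eq_zero_right hs
        rw [← inv_smul_smul₀ hsc w, h1, smul_neg, smul_smul, smul_smul, ← neg_smul]
        congr 1; ring
      have hn : ‖-(s : ℂ)⁻¹ * ((1 - s : ℝ) : ℂ) * e‖ = 1 := by
        have := congrArg norm hw
        rwa [norm_smul, hw1, hu1, mul_one, eq_comm] at this
      have := hscalar (-(s : ℂ)⁻¹ * ((1 - s : ℝ) : ℂ) * e)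
      rw [← hw, hwr, hn] at this
      exact hpr (by simpa using this.symm)
  obtain ⟨s, -, hs⟩ : ∃ s ∈ Set.Icc (0 : ℝ) 1,
      s ^ 2 + s * (1 - s) * ((starRingEnd ℂ) e * α + e * β).re - b * ‖z s‖ ^ 2 = 0 := by
    have hcont : ContinuousOn (fun s : ℝ => s ^ 2 +
        s * (1 - s) * ((starRingEnd ℂ) e * α + e * β).re - b * ‖z s‖ ^ 2) (Set.Icc 0 1) := by
      simp only [z]
      fun_prop
    refine intermediate_value_Icc zero_le_one hcont ⟨?_, ?_⟩
    · simp [z, norm_smul, he1, hu1, hb]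
    · simp [z, hw1]; linarith
  have hnz : ‖z s‖ ≠ 0 := norm_ne_zero_iff.2 (hz0 s)
  have hzC : inner ℂ (z s) (C (z s)) = (p + b * (r - p)) * ‖z s‖ ^ 2 := by
    have h1 := hz s
    rw [sub_eq_zero.1 hs, hD, inner_self_eq_norm_sq_to_K] at h1
    field_simp at h1
    push_cast at h1
    have h2 := sub_eq_iff_eq_add.1 h1
    rw [h2]
    norm_num
    ring
  refine ⟨((‖z s‖⁻¹ : ℝ) : ℂ) • z s, F.smul_mem _ ?_, ?_, ?_⟩
  · exact F.add_mem (F.smul_mem _ (F.smul_mem _ huF)) (F.smul_mem _ hwF)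
  · rw [norm_smul, Complex.norm_real, norm_inv, norm_norm, inv_mul_cancel₀ hnz]
  · rw [map_smul, inner_smul_left, inner_smul_right, hzC, Complex.conj_ofReal]
    have : ((‖z s‖ : ℝ) : ℂ) ≠ 0 := by exact_mod_cast hnz
    push_cast
    field_simp
    have ha' : (a : ℂ) = 1 - b := by exact_mod_cast (eq_sub_of_add_eq hab)
    simp only [Complex.real_smul, ha']
    ring

end NumericalRange

section Pencil

variable {E : Type*} [NormedAddCommGroup E] [InnerProductSpace ℂ E]

theorem inner_eq_zero_of_generalized_eigenvectors {A : E →ₗ[ℂ] E} {M : End ℂ E}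
    (hM : ∀ u x, inner ℂ (M u) (A x) = inner ℂ u (A (M x))) {z w : ℂ}
    (hzw : (starRingEnd ℂ) z ≠ w) (k l : ℕ) {u x : E}
    (hu : ((M - z • (1 : End ℂ E)) ^ k) u = 0) (hx : ((M - w • (1 : End ℂ E)) ^ l) x = 0) :
    inner ℂ u (A x) = 0 := by
  induction k generalizing u x l with
  | zero => simp_all
  | succ k ihk =>
    induction l generalizing x with
    | zero => simp_all
    | succ l ihl =>
      rw [pow_succ, Module.End.mul_apply] at hu hx
      have h1 := ihk (l + 1) hu (by rw [pow_succ, Module.End.mul_apply]; exact hx)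
      have h2 := ihl hx
      simp only [LinearMap.sub_apply, LinearMap.smul_apply, Module.End.one_apply, map_sub,
        map_smul, inner_sub_left, inner_sub_right, inner_smul_left, inner_smul_right] at h1 h2
      have h3 : ((starRingEnd ℂ) z - w) * inner ℂ u (A x) = 0 := by
        linear_combination h2 - h1 + hM u x
      exact (mul_eq_zero.1 h3).resolve_left (sub_ne_zero.2 hzw)

variable [FiniteDimensional ℂ E]

/-- A pencil of symmetric operators without real eigenvalues has a large isotropic subspace. -/
theorem exists_isotropic_of_nonsingular_pencil {A B : E →ₗ[ℂ] E} (hA : A.IsSymmetric)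
    (hB : B.IsSymmetric) (hE : finrank ℂ E = 4)
    (h : ∀ x y : ℝ, (x, y) ≠ 0 → ∀ u, (x : ℂ) • A u + (y : ℂ) • B u = 0 → u = 0) :
    ∃ S : Submodule ℂ E, 2 ≤ finrank ℂ S ∧ ∀ u ∈ S, quadValue A u = 0 ∧ quadValue B u = 0 := by
  have hinj : Function.Injective A := by
    rw [injective_iff_map_eq_zero]
    intro u hu
    exact h 1 0 (by simp) u (by simp [hu])
  let A' := LinearEquiv.ofInjectiveEndo A hinj
  let M : End ℂ E := A'.symm.toLinearMap ∘ₗ B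
  have hAM : ∀ u, A (M u) = B u := fun u => A'.apply_symm_apply (B u)
  have hM : ∀ u x, inner ℂ (M u) (A x) = inner ℂ u (A (M x)) := by
    intro u x
    rw [← hA, hAM, hAM, hB]
  have hreal : ∀ z : ℂ, z.im = 0 → M.maxGenEigenspace z = ⊥ := by
    intro z hz
    have hz' : z = (z.re : ℂ) := Complex.ext (by simp) (by simp [hz])
    have hstep : ∀ u, (M - z • (1 : End ℂ E)) u = 0 → u = 0 := by
      intro u hu
      refine h (-z.re) 1 (by simp) u ?_
      have h1 : M u = z • u := by
        simpa [sub_eq_zero] using hu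
      rw [← hAM, h1, map_smul, Complex.ofReal_neg, ← hz']
      simp
    rw [eq_bot_iff]
    intro u hu
    obtain ⟨k, hk⟩ := (Module.End.mem_maxGenEigenspace _ _ _).1 hu
    induction k with
    | zero => simpa using hk
    | succ k ih =>
      rw [pow_succ', Module.End.mul_apply] at hk
      exact ih (hstep _ hk)
  have main : ∀ P : ℂ → Prop, (∀ z w, P z → P w → (starRingEnd ℂ) z ≠ w) →
      ∀ u ∈ ⨆ z, ⨆ (_ : P z), M.maxGenEigenspace z,
        quadValue A u = 0 ∧ quadValue B u = 0 := by
    intro P hP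
    set S := ⨆ z, ⨆ (_ : P z), M.maxGenEigenspace z with hS
    have hleft : ∀ w, P w → ∀ x ∈ M.maxGenEigenspace w, ∀ u ∈ S, inner ℂ (A x) u = 0 := by
      intro w hw x hx
      obtain ⟨l, hl⟩ := (Module.End.mem_maxGenEigenspace _ _ _).1 hx
      have hle : S ≤ LinearMap.ker (innerₛₗ ℂ (A x)) := by
        refine iSup₂_le fun z hz u hu => ?_
        obtain ⟨k, hk⟩ := (Module.End.mem_maxGenEigenspace _ _ _).1 hu
        rw [LinearMap.mem_ker, innerₛₗ_apply_apply, inner_eq_zero_symm]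
        exact inner_eq_zero_of_generalized_eigenvectors hM (hP z w hz hw) k l hk hl
      intro u hu
      simpa using hle hu
    have hfull : ∀ u ∈ S, ∀ x ∈ S, inner ℂ u (A x) = 0 := by
      intro u hu x hx
      have hle : S ≤ LinearMap.ker ((innerₛₗ ℂ u) ∘ₗ A) := by
        refine iSup₂_le fun w hw x hx => ?_
        rw [LinearMap.mem_ker, LinearMap.comp_apply, innerₛₗ_apply_apply, inner_eq_zero_symm]
        exact hleft w hw x hx u hu
      simpa using hle hx
    have hinv : ∀ u ∈ S, M u ∈ S := by
      have hle : S ≤ S.comap M := by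
        refine iSup₂_le fun w hw x hx => ?_
        exact Submodule.mem_iSup_of_mem w (Submodule.mem_iSup_of_mem hw
          (Module.End.mapsTo_maxGenEigenspace_of_comm (Commute.refl M) w hx))
      exact fun u hu => hle hu
    intro u hu
    rw [quadValue, quadValue, hfull u hu u hu, ← hAM, hfull u hu _ (hinv u hu)]
    simp
  have htop : (⨆ z, ⨆ (_ : 0 < z.im), M.maxGenEigenspace z) ⊔
      (⨆ z, ⨆ (_ : z.im < 0), M.maxGenEigenspace z) = ⊤ := by
    rw [eq_top_iff, ← Module.End.iSup_maxGenEigenspace_eq_top M]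
    refine iSup_le fun z => ?_
    rcases lt_trichotomy z.im 0 with hz | hz | hz
    · exact le_sup_of_le_right (le_iSup₂_of_le z hz le_rfl)
    · rw [hreal z hz]; exact bot_le
    · exact le_sup_of_le_left (le_iSup₂_of_le z hz le_rfl)
  have hdim := Submodule.finrank_add_le_finrank_add_finrank
    (⨆ z, ⨆ (_ : 0 < z.im), M.maxGenEigenspace z) (⨆ z, ⨆ (_ : z.im < 0), M.maxGenEigenspace z)
  rw [htop, finrank_top, hE] at hdim
  by_cases h2 : 2 ≤ finrank ℂ (⨆ z, ⨆ (_ : 0 < z.im), M.maxGenEigenspace z : Submodule ℂ E)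
  · refine ⟨_, h2, main (fun z : ℂ => 0 < z.im) fun z w hz hw hzw => ?_⟩
    have := congrArg Complex.im hzw
    rw [Complex.conj_im] at this
    linarith
  · refine ⟨_, (by omega : 2 ≤ _), main (fun z : ℂ => z.im < 0) fun z w hz hw hzw => ?_⟩
    have := congrArg Complex.im hzw
    rw [Complex.conj_im] at this
    linarith

end Pencil

section PlaneGeometry

/-- A Helly-type alternative: a compact continuous family of open half-planes, any three of
which meet in a fixed ball, has a common point. -/
theorem exists_forall_lt_of_triples {K : Set (ℝ × ℝ)} (hK : IsCompact K) {f : ℝ × ℝ → ℝ}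
    (hf : ContinuousOn f K) (R : ℝ)
    (h : ∀ t : Fin 3 → ℝ × ℝ, (∀ i, t i ∈ K) → ∃ p ∈ Metric.closedBall (0 : ℝ × ℝ) R,
      ∀ i, (t i).1 * p.1 + (t i).2 * p.2 < f (t i)) :
    ∃ p : ℝ × ℝ, ∀ t ∈ K, t.1 * p.1 + t.2 * p.2 < f t := by
  classical
  by_contra hcon
  push Not at hcon
  have hstep : ∀ n : ℕ, ∃ t : Fin 3 → ℝ × ℝ, (∀ i, t i ∈ K) ∧
      ∀ p ∈ Metric.closedBall (0 : ℝ × ℝ) R, ∃ i,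
        f (t i) - 1 / ((n : ℝ) + 1) < (t i).1 * p.1 + (t i).2 * p.2 := by
    intro n
    by_contra hn
    push Not at hn
    have hpos : (0 : ℝ) < 1 / ((n : ℝ) + 1) := by positivity
    let D : K → Set (ℝ × ℝ) := fun t => Metric.closedBall (0 : ℝ × ℝ) R ∩
      {p | t.1.1 * p.1 + t.1.2 * p.2 ≤ f t - 1 / ((n : ℝ) + 1)}
    have hDconv : ∀ t, Convex ℝ (D t) := by
      intro t
      refine (convex_closedBall _ _).inter (convex_halfSpace_le ?_ _)
      exact ⟨fun x y => by simp; ring, fun c x => by simp; ring⟩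
    have hDcomp : ∀ t, IsCompact (D t) := by
      intro t
      refine (isCompact_closedBall _ _).inter_right (isClosed_le ?_ continuous_const)
      fun_prop
    obtain ⟨p, hp⟩ := Convex.helly_theorem_compact' (𝕜 := ℝ) hDconv hDcomp (by
      intro I hI
      rw [Module.finrank_prod, Module.finrank_self] at hI
      rcases I.eq_empty_or_nonempty with rfl | ⟨i₀, hi₀⟩
      · simp
      obtain ⟨g, hg⟩ : ∃ g : Fin 3 → K, ∀ i ∈ I, ∃ j, g j = i := by
        let e := I.equivFin
        refine ⟨fun j => if hj : (j : ℕ) < I.card then (e.symm ⟨j, hj⟩ : K) else i₀,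
          fun i hi => ⟨⟨e ⟨i, hi⟩, lt_of_lt_of_le (e ⟨i, hi⟩).2 hI⟩, ?_⟩⟩
        simp
      obtain ⟨p, hpR, hp⟩ := hn (fun j => g j) (fun j => (g j).2)
      refine ⟨p, Set.mem_iInter₂.2 fun i hi => ⟨hpR, ?_⟩⟩
      obtain ⟨j, rfl⟩ := hg i hi
      exact hp j)
    obtain ⟨t, htK, ht⟩ := hcon p
    have := (Set.mem_iInter.1 hp ⟨t, htK⟩).2
    simp only [Set.mem_ofPred_eq] at this
    linarith
  choose t htK ht using hstep
  have hcomp : IsCompact (Set.pi Set.univ fun _ : Fin 3 => K) := isCompact_univ_pi fun _ => hK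
  obtain ⟨s, hs, φ, hφ, hlim⟩ := hcomp.tendsto_subseq (x := t)
    (fun n => Set.mem_univ_pi.2 (htK n))
  obtain ⟨p, hpR, hp⟩ := h s (Set.mem_univ_pi.1 hs)
  have hev : ∀ᶠ n in Filter.atTop, ∀ i, (t (φ n) i).1 * p.1 + (t (φ n) i).2 * p.2 <
      f (t (φ n) i) - 1 / ((φ n : ℝ) + 1) := by
    rw [Filter.eventually_all]
    intro i
    have hi : Filter.Tendsto (fun n => t (φ n) i) Filter.atTop (nhds (s i)) :=
      (tendsto_pi_nhds.1 hlim) i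
    have h1 : Filter.Tendsto (fun n => (t (φ n) i).1 * p.1 + (t (φ n) i).2 * p.2) Filter.atTop
        (nhds ((s i).1 * p.1 + (s i).2 * p.2)) :=
      ((by fun_prop : Continuous fun x : ℝ × ℝ => x.1 * p.1 + x.2 * p.2).tendsto (s i)).comp hi
    have h2 : Filter.Tendsto (fun n => f (t (φ n) i)) Filter.atTop (nhds (f (s i))) := by
      refine (hf (s i) (Set.mem_univ_pi.1 hs i)).tendsto.comp ?_
      exact tendsto_nhdsWithin_iff.2 ⟨hi, Filter.Eventually.of_forall fun n => htK _ i⟩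
    have h3 : Filter.Tendsto (fun n => 1 / ((φ n : ℝ) + 1)) Filter.atTop (nhds 0) :=
      tendsto_one_div_add_atTop_nhds_zero_nat.comp hφ.tendsto_atTop
    exact h1.eventually_lt (h2.sub h3) (by simpa using hp i)
  obtain ⟨n, hn⟩ := hev.exists
  obtain ⟨i, hi⟩ := ht (φ n) p hpR
  exact absurd (hn i) (not_lt.2 hi.le)

/-- The alternative theorem of Gordan in the plane. -/
theorem exists_nonneg_combination_eq_zero (t : Fin 3 → ℝ × ℝ) (I : Finset (Fin 3))
    (h : ∀ d : ℝ × ℝ, ∃ i ∈ I, 0 ≤ (t i).1 * d.1 + (t i).2 * d.2) :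
    ∃ w : Fin 3 → ℝ, (∀ i, 0 ≤ w i) ∧ (∀ i ∉ I, w i = 0) ∧ ∑ i, w i = 1 ∧
      ∑ i, w i * (t i).1 = 0 ∧ ∑ i, w i * (t i).2 = 0 := by
  classical
  have hmem : (0 : ℝ × ℝ) ∈ convexHull ℝ (t '' I) := by
    by_contra hnot
    obtain ⟨g, u, hg, hu⟩ := geometric_hahn_banach_closed_point (convex_convexHull ℝ (t '' I))
      ((I.finite_toSet.image t).isClosed_convexHull ℝ) hnot
    rw [map_zero] at hu
    obtain ⟨i, hi, hd⟩ := h (g (1, 0), g (0, 1))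
    have h1 := hg (t i) (subset_convexHull ℝ _ ⟨i, hi, rfl⟩)
    have h2 : t i = (t i).1 • ((1, 0) : ℝ × ℝ) + (t i).2 • ((0, 1) : ℝ × ℝ) := by
      ext <;> simp
    rw [h2, map_add, map_smul, map_smul, smul_eq_mul, smul_eq_mul] at h1
    simp only at hd
    linarith
  have hset : Convex ℝ {x : ℝ × ℝ | ∃ w : Fin 3 → ℝ, (∀ i, 0 ≤ w i) ∧ (∀ i ∉ I, w i = 0) ∧
      ∑ i, w i = 1 ∧ ∑ i, w i • t i = x} := by
    rintro x ⟨w, hw, hwI, hw1, rfl⟩ y ⟨v, hv, hvI, hv1, rfl⟩ a b ha hb hab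
    refine ⟨fun i => a * w i + b * v i, fun i => ?_, fun i hi => ?_, ?_, ?_⟩
    · have := hw i; have := hv i; positivity
    · simp [hwI i hi, hvI i hi]
    · rw [Finset.sum_add_distrib, ← Finset.mul_sum, ← Finset.mul_sum, hw1, hv1]; linarith
    · simp only [add_smul, mul_smul, Finset.sum_add_distrib, Finset.smul_sum]
  obtain ⟨w, hw, hwI, hw1, hw0⟩ := convexHull_min (by
    rintro _ ⟨i, hi, rfl⟩
    refine ⟨Pi.single i 1, fun j => ?_, fun j hj => ?_, by simp, ?_⟩
    · by_cases hij : j = i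
      · subst hij; simp
      · simp [hij]
    · have : j ≠ i := fun hij => hj (hij ▸ hi)
      simp [this]
    · simp [Pi.single_apply]) hset hmem
  refine ⟨w, hw, hwI, hw1, ?_, ?_⟩
  · simpa [Prod.fst_sum] using congrArg Prod.fst hw0
  · simpa [Prod.snd_sum] using congrArg Prod.snd hw0

end PlaneGeometry

section ScalarCompression

variable {E : Type*} [NormedAddCommGroup E] [InnerProductSpace ℂ E] [FiniteDimensional ℂ E]

theorem exists_abs_quadValue_le (T : E →ₗ[ℂ] E) : ∃ C : ℝ, ∀ v, |quadValue T v| ≤ C * ‖v‖ ^ 2 := by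
  refine ⟨‖LinearMap.toContinuousLinearMap T‖, fun v => ?_⟩
  calc |quadValue T v| ≤ ‖inner ℂ v (T v)‖ := Complex.abs_re_le_norm _
    _ ≤ ‖v‖ * ‖T v‖ := norm_inner_le_norm _ _
    _ ≤ ‖v‖ * (‖LinearMap.toContinuousLinearMap T‖ * ‖v‖) := by
        gcongr
        exact (LinearMap.toContinuousLinearMap T).le_opNorm v
    _ = _ := by ring

/-- Both forms are constant on the unit sphere of some plane. -/
def HasScalarPlane (A B : E →ₗ[ℂ] E) : Prop :=
  ∃ (c d : ℝ) (S : Submodule ℂ E), 2 ≤ finrank ℂ S ∧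
    ∀ u ∈ S, quadValue A u = c * ‖u‖ ^ 2 ∧ quadValue B u = d * ‖u‖ ^ 2

omit [FiniteDimensional ℂ E] in
theorem HasScalarPlane.of_sub_scalar {A B : E →ₗ[ℂ] E} (a b : ℝ)
    (h : HasScalarPlane (A - (a : ℂ) • LinearMap.id) (B - (b : ℂ) • LinearMap.id)) :
    HasScalarPlane A B := by
  obtain ⟨c, d, S, hS, h⟩ := h
  refine ⟨c + a, d + b, S, hS, fun u hu => ?_⟩
  have := h u hu
  rw [quadValue_sub_scalar, quadValue_sub_scalar] at this
  exact ⟨by linarith [this.1], by linarith [this.2]⟩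

/-- If some nontrivial real combination is semidefinite of both signs on hyperplanes, then the
pair has a scalar plane. -/
theorem hasScalarPlane_of_degenerate_combination {A B : E →ₗ[ℂ] E} (hA : A.IsSymmetric)
    (hB : B.IsSymmetric) (hE : finrank ℂ E = 4) {x y : ℝ} (hxy : 0 < x ^ 2 + y ^ 2)
    {S U : Submodule ℂ E} (hS : 3 ≤ finrank ℂ S) (hU : 3 ≤ finrank ℂ U)
    (hSn : ∀ u ∈ S, x * quadValue A u + y * quadValue B u ≤ 0)
    (hUp : ∀ u ∈ U, 0 ≤ x * quadValue A u + y * quadValue B u) : HasScalarPlane A B := by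
  obtain ⟨W, hW, hW0⟩ := exists_isotropic_of_codim_one (hA.real_combination hB x y) (m := 3) hE
    hS hU (fun v hv => by rw [quadValue_combination]; exact hSn v hv)
    (fun v hv => by rw [quadValue_combination]; exact hUp v hv)
  obtain ⟨r, P, hPW, hP, hPr⟩ := exists_plane_quadValue_eq (hA.real_combination hB (-y) x) W hW
  refine ⟨-y * r / (x ^ 2 + y ^ 2), x * r / (x ^ 2 + y ^ 2), P, hP, fun u hu => ?_⟩
  have h1 := hW0 u (hPW hu)
  have h2 := hPr u hu
  rw [quadValue_combination] at h1 h2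
  constructor
  · field_simp
    linear_combination x * h1 - y * h2
  · field_simp
    linear_combination y * h1 + x * h2

/-- If `v` is a common null vector and three positively dependent combinations are each
nonpositive on hyperplanes, then there is an isotropic plane through `v`. -/
theorem hasScalarPlane_of_common_kernel {A B : E →ₗ[ℂ] E} (hA : A.IsSymmetric)
    (hB : B.IsSymmetric) (hE : finrank ℂ E = 4) {v : E} (hv : v ≠ 0) (hAv : A v = 0)
    (hBv : B v = 0) {t₁ t₂ t₃ : ℝ × ℝ} {w₁ w₂ w₃ : ℝ} (hw₁ : 0 < w₁) (hw₂ : 0 < w₂)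
    (hw₃ : 0 < w₃) (hfst : w₁ * t₁.1 + w₂ * t₂.1 + w₃ * t₃.1 = 0)
    (hsnd : w₁ * t₁.2 + w₂ * t₂.2 + w₃ * t₃.2 = 0) (hdet : t₁.1 * t₂.2 - t₁.2 * t₂.1 ≠ 0)
    {S₁ S₂ S₃ : Submodule ℂ E} (hS₁ : 3 ≤ finrank ℂ S₁) (hS₂ : 3 ≤ finrank ℂ S₂)
    (hS₃ : 3 ≤ finrank ℂ S₃)
    (h₁ : ∀ u ∈ S₁, t₁.1 * quadValue A u + t₁.2 * quadValue B u ≤ 0)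
    (h₂ : ∀ u ∈ S₂, t₂.1 * quadValue A u + t₂.2 * quadValue B u ≤ 0)
    (h₃ : ∀ u ∈ S₃, t₃.1 * quadValue A u + t₃.2 * quadValue B u ≤ 0) :
    HasScalarPlane A B := by
  set F := (Submodule.span ℂ {v})ᗮ with hF
  have hFdim : finrank ℂ F = 3 := by
    have h1 := Submodule.finrank_add_finrank_orthogonal (Submodule.span ℂ {v})
    rw [finrank_span_singleton hv, hE, ← hF] at h1
    omega
  have hpair : ∀ {S U : Submodule ℂ E}, 3 ≤ finrank ℂ S → 3 ≤ finrank ℂ U →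
      ∃ x ∈ F, x ∈ S ∧ x ∈ U ∧ ‖x‖ = 1 := by
    intro S U hS hU
    have h1 := finrank_add_le_finrank_inf_add S U
    obtain ⟨x, hx, hxF, hx0⟩ := exists_mem_inf_ne_zero (S := S ⊓ U) (T := F) (by omega)
    refine ⟨((‖x‖⁻¹ : ℝ) : ℂ) • x, F.smul_mem _ hxF, S.smul_mem _ hx.1, U.smul_mem _ hx.2, ?_⟩
    rw [norm_smul, Complex.norm_real, norm_inv, norm_norm,
      inv_mul_cancel₀ (norm_ne_zero_iff.2 hx0)]
  obtain ⟨a, haF, ha₂, ha₃, ha⟩ := hpair hS₂ hS₃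
  obtain ⟨b, hbF, hb₁, hb₃, hb⟩ := hpair hS₁ hS₃
  obtain ⟨c, hcF, hc₁, hc₂, hc⟩ := hpair hS₁ hS₂
  let C : E →ₗ[ℂ] E := A + Complex.I • B
  have hC : ∀ u, inner ℂ u (C u) = (quadValue A u : ℂ) + Complex.I * (quadValue B u : ℂ) := by
    intro u
    rw [← hA.inner_self_eq_quadValue, ← hB.inner_self_eq_quadValue]
    simp [C]
  have hzero : (0 : ℂ) ∈ {z : ℂ | ∃ u ∈ F, ‖u‖ = 1 ∧ inner ℂ u (C u) = z} := by
    set s : Set ℂ := {inner ℂ a (C a), inner ℂ b (C b), inner ℂ c (C c)} with hs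
    have hsub : convexHull ℝ s ⊆ {z : ℂ | ∃ u ∈ F, ‖u‖ = 1 ∧ inner ℂ u (C u) = z} := by
      refine convexHull_min ?_ (convex_numericalRange C F)
      rintro z (rfl | rfl | rfl)
      exacts [⟨a, haF, ha, rfl⟩, ⟨b, hbF, hb, rfl⟩, ⟨c, hcF, hc, rfl⟩]
    apply hsub
    by_contra hnot
    obtain ⟨g, u, hg, hu⟩ := geometric_hahn_banach_closed_point (convex_convexHull ℝ s)
      ((by simp [s] : s.Finite).isClosed_convexHull ℝ) hnot
    rw [map_zero] at hu
    have hgC : ∀ x, g (inner ℂ x (C x)) = quadValue A x * g 1 + quadValue B x * g Complex.I := by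
      intro x
      have : inner ℂ x (C x) = quadValue A x • (1 : ℂ) + quadValue B x • Complex.I := by
        rw [hC]; simp [mul_comm]
      rw [this, map_add, map_smul, map_smul, smul_eq_mul, smul_eq_mul]
    have hga := (hg _ (subset_convexHull ℝ s (by simp [s] : inner ℂ a (C a) ∈ s))).trans hu
    have hgb := (hg _ (subset_convexHull ℝ s (by simp [s] : inner ℂ b (C b) ∈ s))).trans hu
    have hgc := (hg _ (subset_convexHull ℝ s (by simp [s] : inner ℂ c (C c) ∈ s))).trans hu
    rw [hgC] at hga hgb hgc
    obtain ⟨σ, τ, hσ, hτ⟩ : ∃ σ τ : ℝ, g 1 = σ * (w₁ * t₁.1) + τ * (w₂ * t₂.1) ∧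
        g Complex.I = σ * (w₁ * t₁.2) + τ * (w₂ * t₂.2) := by
      obtain ⟨Δ, hΔ⟩ : ∃ Δ, Δ = t₁.1 * t₂.2 - t₁.2 * t₂.1 := ⟨_, rfl⟩
      have hΔ0 : Δ ≠ 0 := hΔ ▸ hdet
      refine ⟨(g 1 * t₂.2 - g Complex.I * t₂.1) / Δ / w₁,
        (g Complex.I * t₁.1 - g 1 * t₁.2) / Δ / w₂, ?_, ?_⟩ <;>
      · field_simp
        rw [hΔ]
        ring
    rw [hσ, hτ] at hga hgb hgc
    have a₂ := mul_nonpos_of_nonneg_of_nonpos hw₂.le (h₂ a ha₂)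
    have a₃ := mul_nonpos_of_nonneg_of_nonpos hw₃.le (h₃ a ha₃)
    have b₁ := mul_nonpos_of_nonneg_of_nonpos hw₁.le (h₁ b hb₁)
    have b₃ := mul_nonpos_of_nonneg_of_nonpos hw₃.le (h₃ b hb₃)
    have c₁ := mul_nonpos_of_nonneg_of_nonpos hw₁.le (h₁ c hc₁)
    have c₂ := mul_nonpos_of_nonneg_of_nonpos hw₂.le (h₂ c hc₂)
    have hsum : ∀ x, w₁ * (t₁.1 * quadValue A x + t₁.2 * quadValue B x) +
        w₂ * (t₂.1 * quadValue A x + t₂.2 * quadValue B x) +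
        w₃ * (t₃.1 * quadValue A x + t₃.2 * quadValue B x) = 0 := by
      intro x
      linear_combination quadValue A x * hfst + quadValue B x * hsnd
    have sa := hsum a
    have sb := hsum b
    rcases le_total σ τ with hστ | hστ
    · rcases le_total τ 0 with h0 | h0
      · have e₁ := mul_nonneg_of_nonpos_of_nonpos (hστ.trans h0) c₁
        have e₂ := mul_nonneg_of_nonpos_of_nonpos h0 c₂
        linarith
      · have e₁ := mul_nonneg_of_nonpos_of_nonpos (sub_nonpos.2 hστ) b₁
        have e₃ := mul_nonneg_of_nonpos_of_nonpos (neg_nonpos.2 h0) b₃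
        have := congrArg (τ * ·) sb
        linarith
    · rcases le_total σ 0 with h0 | h0
      · have e₁ := mul_nonneg_of_nonpos_of_nonpos h0 c₁
        have e₂ := mul_nonneg_of_nonpos_of_nonpos (hστ.trans h0) c₂
        linarith
      · have e₂ := mul_nonneg_of_nonpos_of_nonpos (sub_nonpos.2 hστ) a₂
        have e₃ := mul_nonneg_of_nonpos_of_nonpos (neg_nonpos.2 h0) a₃
        have := congrArg (σ * ·) sa
        linarith
  obtain ⟨x, hxF, hx1, hx⟩ := hzero
  rw [hC] at hx
  have hxA : quadValue A x = 0 := by simpa using congrArg Complex.re hx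
  have hxB : quadValue B x = 0 := by simpa using congrArg Complex.im hx
  have hxv : x ∉ Submodule.span ℂ {v} := by
    intro hmem
    have h0 : inner ℂ x x = 0 := Submodule.inner_right_of_mem_orthogonal hmem hxF
    rw [inner_self_eq_zero.1 h0, norm_zero] at hx1
    exact zero_ne_one hx1
  refine ⟨0, 0, Submodule.span ℂ {v} ⊔ Submodule.span ℂ {x}, ?_, ?_⟩
  · have := finrank_lt_finrank_sup_span hxv
    rw [finrank_span_singleton hv] at this
    omega
  · intro u hu
    obtain ⟨p, hp, q, hq, rfl⟩ := Submodule.mem_sup.1 hu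
    obtain ⟨y, rfl⟩ := Submodule.mem_span_singleton.1 hp
    obtain ⟨z, rfl⟩ := Submodule.mem_span_singleton.1 hq
    rw [add_comm (y • v), quadValue_add hA, quadValue_add hB, quadValue_smul, quadValue_smul,
      quadValue_smul, quadValue_smul, hxA, hxB]
    simp [hAv, hBv, quadValue]

theorem exists_third_index {i j : Fin 3} (h : i ≠ j) :
    ∃ k, ∀ f : Fin 3 → ℝ, ∑ l, f l = f i + f j + f k := by
  fin_cases i <;> fin_cases j <;> first | exact absurd rfl h | skip
  · exact ⟨2, fun f => by simp [Fin.sum_univ_three]⟩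
  · exact ⟨1, fun f => by simp [Fin.sum_univ_three]; ring⟩
  · exact ⟨2, fun f => by simp [Fin.sum_univ_three]; ring⟩
  · exact ⟨0, fun f => by simp [Fin.sum_univ_three]; ring⟩
  · exact ⟨1, fun f => by simp [Fin.sum_univ_three]; ring⟩
  · exact ⟨0, fun f => by simp [Fin.sum_univ_three]; ring⟩

theorem hasScalarPlane_of_balanced_triple {A B : E →ₗ[ℂ] E} (hA : A.IsSymmetric)
    (hB : B.IsSymmetric) (hE : finrank ℂ E = 4) {v : E} (hv : v ≠ 0) {t : Fin 3 → ℝ × ℝ}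
    (ht : ∀ i, t i ≠ 0) {w : Fin 3 → ℝ} (hw : ∀ i, 0 ≤ w i) (hw1 : ∑ i, w i = 1)
    (hfst : ∑ i, w i * (t i).1 = 0) (hsnd : ∑ i, w i * (t i).2 = 0)
    (hker : ∀ i, 0 < w i → ((t i).1 : ℂ) • A v + ((t i).2 : ℂ) • B v = 0)
    (S : Fin 3 → Submodule ℂ E) (hS : ∀ i, 3 ≤ finrank ℂ (S i))
    (hneg : ∀ i, 0 < w i → ∀ u ∈ S i, (t i).1 * quadValue A u + (t i).2 * quadValue B u ≤ 0) :
    HasScalarPlane A B := by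
  obtain ⟨i, hi⟩ : ∃ i, 0 < w i := by
    by_contra! hcon
    have := Finset.sum_nonpos fun i (_ : i ∈ Finset.univ) => hcon i
    linarith
  have hti : 0 < (t i).1 ^ 2 + (t i).2 ^ 2 := by
    by_contra hcon
    apply ht i
    ext
    · simp only [Prod.fst_zero]; nlinarith [sq_nonneg (t i).1, sq_nonneg (t i).2]
    · simp only [Prod.snd_zero]; nlinarith [sq_nonneg (t i).1, sq_nonneg (t i).2]
  by_cases hpar : ∀ j, 0 < w j → (t i).1 * (t j).2 - (t i).2 * (t j).1 = 0
  · obtain ⟨j, hj⟩ : ∃ j, w j * ((t i).1 * (t j).1 + (t i).2 * (t j).2) < 0 := by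
      by_contra! hcon
      have hle := Finset.single_le_sum (fun j _ => hcon j) (Finset.mem_univ i)
      have hsum : ∑ j, w j * ((t i).1 * (t j).1 + (t i).2 * (t j).2) = 0 := by
        calc _ = (t i).1 * ∑ j, w j * (t j).1 + (t i).2 * ∑ j, w j * (t j).2 := by
              rw [Finset.mul_sum, Finset.mul_sum, ← Finset.sum_add_distrib]
              exact Finset.sum_congr rfl fun j _ => by ring
          _ = 0 := by rw [hfst, hsnd]; ring
      rw [hsum] at hle
      nlinarith
    have hwj : 0 < w j := lt_of_le_of_ne (hw j) fun h0 => by simp [← h0] at hj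
    have hdot : (t i).1 * (t j).1 + (t i).2 * (t j).2 < 0 := by
      by_contra! hcon
      exact absurd hj (not_lt.2 (mul_nonneg hwj.le hcon))
    have hd := hpar j hwj
    refine hasScalarPlane_of_degenerate_combination hA hB hE hti (hS i) (hS j) (hneg i hi) ?_
    intro u hu
    have h1 := hneg j hwj u hu
    have h2 : ((t i).1 ^ 2 + (t i).2 ^ 2) * ((t j).1 * quadValue A u + (t j).2 * quadValue B u) =
        ((t i).1 * (t j).1 + (t i).2 * (t j).2) *
          ((t i).1 * quadValue A u + (t i).2 * quadValue B u) := by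
      linear_combination ((t i).1 * quadValue B u - (t i).2 * quadValue A u) * hd
    by_contra! hcon
    have := mul_pos_of_neg_of_neg hdot hcon
    have := mul_nonpos_of_nonneg_of_nonpos hti.le h1
    linarith
  · push Not at hpar
    obtain ⟨j, hj, hdet⟩ := hpar
    have hij : i ≠ j := by
      rintro rfl
      apply hdet; ring
    obtain ⟨k, hk⟩ := exists_third_index hij
    rw [hk] at hfst hsnd
    have hwk : 0 < w k := by
      refine lt_of_le_of_ne (hw k) fun h0 => hdet ?_
      rw [← h0] at hfst hsnd
      have : w i * ((t i).1 * (t j).2 - (t i).2 * (t j).1) = 0 := by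
        linear_combination (t j).2 * hfst - (t j).1 * hsnd
      exact (mul_eq_zero.1 this).resolve_left hi.ne'
    have hdet' : (((t i).1 * (t j).2 - (t i).2 * (t j).1 : ℝ) : ℂ) ≠ 0 := by exact_mod_cast hdet
    have hAv : A v = 0 := by
      have : (((t i).1 * (t j).2 - (t i).2 * (t j).1 : ℝ) : ℂ) • A v = 0 := by
        push_cast
        linear_combination (norm := module) ((t j).2 : ℂ) • hker i hi - ((t i).2 : ℂ) • hker j hj
      exact (smul_eq_zero.1 this).resolve_left hdet'
    have hBv : B v = 0 := by
      have : (((t i).1 * (t j).2 - (t i).2 * (t j).1 : ℝ) : ℂ) • B v = 0 := by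
        push_cast
        linear_combination (norm := module) ((t i).1 : ℂ) • hker j hj - ((t j).1 : ℂ) • hker i hi
      exact (smul_eq_zero.1 this).resolve_left hdet'
    exact hasScalarPlane_of_common_kernel hA hB hE hv hAv hBv hi hj hwk hfst hsnd hdet (hS i)
      (hS j) (hS k) (hneg i hi) (hneg j hj) (hneg k hwk)

end ScalarCompression

section ScalarPlane

variable {E : Type*} [NormedAddCommGroup E] [InnerProductSpace ℂ E] [FiniteDimensional ℂ E]

/-- The second largest eigenvalue of `t.1 • A + t.2 • B`, or any other number separating a plane
from a `3`-space in the same way, depends continuously on `t`. -/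
theorem continuous_of_spectral_splitting {A B : E →ₗ[ℂ] E} (hE : finrank ℂ E = 4)
    {r : ℝ × ℝ → ℝ} {U S : ℝ × ℝ → Submodule ℂ E} (hU : ∀ t, finrank ℂ (U t) = 2)
    (hS : ∀ t, finrank ℂ (S t) = 3)
    (hUr : ∀ t, ∀ v ∈ U t, r t * ‖v‖ ^ 2 ≤ t.1 * quadValue A v + t.2 * quadValue B v)
    (hSr : ∀ t, ∀ v ∈ S t, t.1 * quadValue A v + t.2 * quadValue B v ≤ r t * ‖v‖ ^ 2) :
    Continuous r := by
  obtain ⟨a, ha⟩ := exists_abs_quadValue_le A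
  obtain ⟨b, hb⟩ := exists_abs_quadValue_le B
  refine (LipschitzWith.of_le_add_mul' (a + b) fun t s => ?_).continuous
  obtain ⟨v, hvU, hvS, hv⟩ := exists_mem_inf_ne_zero (S := U t) (T := S s)
    (by rw [hE, hU, hS]; norm_num)
  have hv2 : 0 < ‖v‖ ^ 2 := by positivity
  have h1 := hUr t v hvU
  have h2 := hSr s v hvS
  have hd₁ : |t.1 - s.1| ≤ dist t s := by
    rw [← Real.dist_eq]; exact le_max_left _ _
  have hd₂ : |t.2 - s.2| ≤ dist t s := by
    rw [← Real.dist_eq]; exact le_max_right _ _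
  have e₁ : (t.1 - s.1) * quadValue A v ≤ dist t s * (a * ‖v‖ ^ 2) :=
    (le_abs_self _).trans (by rw [abs_mul]; gcongr; exact ha v)
  have e₂ : (t.2 - s.2) * quadValue B v ≤ dist t s * (b * ‖v‖ ^ 2) :=
    (le_abs_self _).trans (by rw [abs_mul]; gcongr; exact hb v)
  refine le_of_mul_le_mul_right ?_ hv2
  linarith

/-- If every nonzero combination of `A` and `B` is positive definite on a plane, then no nonzero
combination is singular. -/
theorem pencil_nonsingular_of_pos_planes {A B : E →ₗ[ℂ] E} (hA : A.IsSymmetric)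
    (hB : B.IsSymmetric) (hE : finrank ℂ E = 4) {U : ℝ × ℝ → Submodule ℂ E}
    (hU : ∀ t, finrank ℂ (U t) = 2)
    (hpos : ∀ t : ℝ × ℝ, t ≠ 0 → ∀ v ∈ U t, v ≠ 0 →
      0 < t.1 * quadValue A v + t.2 * quadValue B v)
    (x y : ℝ) (hxy : (x, y) ≠ (0, 0)) (u : E) (hu : (x : ℂ) • A u + (y : ℂ) • B u = 0) :
    u = 0 := by
  by_contra hu0
  set T := (x : ℂ) • A + (y : ℂ) • B with hT
  have hTs : T.IsSymmetric := hA.real_combination hB x y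
  have hTu : T u = 0 := hu
  have hxy0 : (x, y) ≠ (0 : ℝ × ℝ) := hxy
  have hq : ∀ v, quadValue T v = x * quadValue A v + y * quadValue B v :=
    quadValue_combination A B x y
  have huU : u ∉ U (x, y) := by
    intro hmem
    have := hpos (x, y) hxy0 u hmem hu0
    simp only [← hq] at this
    simp [quadValue, hTu] at this
  have hdim := finrank_lt_finrank_sup_span huU
  rw [hU] at hdim
  obtain ⟨z, hz, hzU, hz0⟩ := exists_mem_inf_ne_zero
    (S := U (x, y) ⊔ Submodule.span ℂ {u}) (T := U (-(x, y))) (by rw [hE, hU]; omega)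
  obtain ⟨p, hp, w, hw, rfl⟩ := Submodule.mem_sup.1 hz
  obtain ⟨c, rfl⟩ := Submodule.mem_span_singleton.1 hw
  have hneg := hpos (-(x, y)) (neg_ne_zero.2 hxy0) _ hzU hz0
  simp only [Prod.fst_neg, Prod.snd_neg] at hneg
  have hval : quadValue T (p + c • u) = quadValue T p := by
    rw [quadValue_add hTs, quadValue_smul]
    simp [quadValue, hTu]
  have hp0 : 0 ≤ quadValue T p := by
    by_cases hpz : p = 0
    · simp [hpz, quadValue]
    · rw [hq]; exact (hpos (x, y) hxy0 p hp hpz).le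
  rw [← hval, hq] at hp0
  linarith

theorem exists_mem_inf_three {S : Fin 3 → Submodule ℂ E} (hE : finrank ℂ E = 4)
    (hS : ∀ i, finrank ℂ (S i) = 3) : ∃ v, ‖v‖ = 1 ∧ ∀ i, v ∈ S i := by
  have h1 := finrank_add_le_finrank_inf_add (S 0) (S 1)
  rw [hS, hS, hE] at h1
  obtain ⟨x, hx, hx2, hx0⟩ := exists_mem_inf_ne_zero (S := S 0 ⊓ S 1) (T := S 2)
    (by rw [hE, hS]; omega)
  refine ⟨((‖x‖⁻¹ : ℝ) : ℂ) • x, ?_, fun i => (S i).smul_mem _ ?_⟩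
  · rw [norm_smul, Complex.norm_real, norm_inv, norm_norm,
      inv_mul_cancel₀ (norm_ne_zero_iff.2 hx0)]
  · fin_cases i
    exacts [hx.1, hx.2, hx2]

/-- A pair of symmetric operators on a `4`-dimensional space has a scalar plane: the rank-two
numerical range of an operator on a `4`-dimensional space is nonempty. -/
theorem hasScalarPlane_of_finrank_eq_four {A B : E →ₗ[ℂ] E} (hA : A.IsSymmetric)
    (hB : B.IsSymmetric) (hE : finrank ℂ E = 4) : HasScalarPlane A B := by
  choose r U S hU hS hUr hSr hSeq using fun t : ℝ × ℝ =>
    exists_spectral_splitting (hA.real_combination hB t.1 t.2) (n := 4) (k := 2) (l := 3) hE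
      (by norm_num) (by norm_num) (by norm_num)
  simp only [quadValue_combination] at hUr hSr hSeq
  have hr : Continuous r := continuous_of_spectral_splitting hE hU hS hUr hSr
  by_cases hex : ∃ p : ℝ × ℝ, ∀ t ∈ Metric.sphere (0 : ℝ × ℝ) 1, t.1 * p.1 + t.2 * p.2 < r t
  · obtain ⟨p, hp⟩ := hex
    apply HasScalarPlane.of_sub_scalar p.1 p.2
    have hA' := hA.sub_scalar p.1
    have hB' := hB.sub_scalar p.2
    have hpos : ∀ t : ℝ × ℝ, t ≠ 0 → ∀ v ∈ U (‖t‖⁻¹ • t), v ≠ 0 →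
        0 < t.1 * quadValue (A - (p.1 : ℂ) • LinearMap.id) v +
          t.2 * quadValue (B - (p.2 : ℂ) • LinearMap.id) v := by
      intro t ht v hv hv0
      have htn : 0 < ‖t‖ := norm_pos_iff.2 ht
      have h1 := hUr _ v hv
      have h2 := hp (‖t‖⁻¹ • t) (by
        rw [mem_sphere_zero_iff_norm, norm_smul, norm_inv, norm_norm, inv_mul_cancel₀ htn.ne'])
      have hv2 : 0 < ‖v‖ ^ 2 := by positivity
      have h3 := mul_lt_mul_of_pos_right h2 hv2
      rw [quadValue_sub_scalar, quadValue_sub_scalar]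
      simp only [Prod.smul_fst, Prod.smul_snd, smul_eq_mul] at h1 h3
      have h4 : 0 < ‖t‖⁻¹ * (t.1 * (quadValue A v - p.1 * ‖v‖ ^ 2) +
          t.2 * (quadValue B v - p.2 * ‖v‖ ^ 2)) := by linarith
      exact (mul_pos_iff_of_pos_left (inv_pos.2 htn)).1 h4
    obtain ⟨P, hP, hPq⟩ := exists_isotropic_of_nonsingular_pencil hA' hB' hE
      (pencil_nonsingular_of_pos_planes hA' hB' hE (U := fun t => U (‖t‖⁻¹ • t))
        (fun t => hU _) hpos)
    exact ⟨0, 0, P, hP, fun u hu => by simpa using hPq u hu⟩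
  · obtain ⟨a, ha⟩ := exists_abs_quadValue_le A
    obtain ⟨b, hb⟩ := exists_abs_quadValue_le B
    have htriple : ∃ t : Fin 3 → ℝ × ℝ, (∀ i, t i ∈ Metric.sphere (0 : ℝ × ℝ) 1) ∧
        ∀ p ∈ Metric.closedBall (0 : ℝ × ℝ) (max a b + 1),
          ∃ i, r (t i) ≤ (t i).1 * p.1 + (t i).2 * p.2 := by
      by_contra! hcon
      exact hex (exists_forall_lt_of_triples (isCompact_sphere 0 1) hr.continuousOn _ hcon)
    obtain ⟨t, ht, hcover⟩ := htriple
    obtain ⟨v, hv1, hvS⟩ := exists_mem_inf_three (S := fun i => S (t i)) hE fun i => hS _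
    have hle : ∀ i, (t i).1 * quadValue A v + (t i).2 * quadValue B v ≤ r (t i) := by
      intro i
      simpa [hv1] using hSr (t i) v (hvS i)
    set p : ℝ × ℝ := (quadValue A v, quadValue B v) with hp
    have hpnorm : ‖p‖ ≤ max a b := by
      have h1 := ha v
      have h2 := hb v
      rw [hv1, one_pow, mul_one] at h1 h2
      exact max_le_max h1 h2
    classical
    let I : Finset (Fin 3) :=
      {i | r (t i) = (t i).1 * quadValue A v + (t i).2 * quadValue B v}
    have hgordan : ∀ d : ℝ × ℝ, ∃ i ∈ I, 0 ≤ (t i).1 * d.1 + (t i).2 * d.2 := by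
      intro d
      have hball : ∀ᶠ ε : ℝ in nhdsWithin 0 (Set.Ioi 0),
          p + ε • d ∈ Metric.closedBall (0 : ℝ × ℝ) (max a b + 1) := by
        have hcont : Filter.Tendsto (fun ε : ℝ => ‖p + ε • d‖) (nhds 0) (nhds ‖p‖) := by
          have : Continuous fun ε : ℝ => ‖p + ε • d‖ := by fun_prop
          simpa using this.tendsto 0
        filter_upwards [(hcont.eventually_lt_const
          (hpnorm.trans_lt (lt_add_one _))).filter_mono nhdsWithin_le_nhds] with ε hε
        rw [mem_closedBall_zero_iff]
        exact hε.le
      have hout : ∀ᶠ ε : ℝ in nhdsWithin 0 (Set.Ioi 0), ∀ i, i ∉ I →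
          (t i).1 * (p + ε • d).1 + (t i).2 * (p + ε • d).2 < r (t i) := by
        refine Filter.eventually_all.2 fun i => ?_
        by_cases hi : i ∈ I
        · exact Filter.Eventually.of_forall fun ε h => absurd hi h
        have hlt : (t i).1 * p.1 + (t i).2 * p.2 < r (t i) :=
          lt_of_le_of_ne (hle i) fun h => hi (by simpa [I] using h.symm)
        have hcont : Filter.Tendsto
            (fun ε : ℝ => (t i).1 * (p + ε • d).1 + (t i).2 * (p + ε • d).2) (nhds 0)
            (nhds ((t i).1 * p.1 + (t i).2 * p.2)) := by
          have : Continuous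
              fun ε : ℝ => (t i).1 * (p + ε • d).1 + (t i).2 * (p + ε • d).2 := by fun_prop
          simpa using this.tendsto 0
        filter_upwards [(hcont.eventually_lt_const hlt).filter_mono nhdsWithin_le_nhds]
          with ε hε _ using hε
      obtain ⟨ε, ⟨hεball, hεout⟩, hε⟩ := ((hball.and hout).and self_mem_nhdsWithin).exists
      obtain ⟨i, hi⟩ := hcover _ hεball
      have hiI : i ∈ I := by
        by_contra h
        exact absurd (hεout i h) (not_lt.2 hi)
      refine ⟨i, hiI, ?_⟩
      have heq : r (t i) = (t i).1 * p.1 + (t i).2 * p.2 := by simpa [I] using hiI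
      rw [heq] at hi
      simp only [Prod.fst_add, Prod.snd_add, Prod.smul_fst, Prod.smul_snd, smul_eq_mul] at hi
      refine nonneg_of_mul_nonneg_right (?_ : 0 ≤ ε * _) hε
      linarith
    obtain ⟨w, hw, hwI, hw1, hfst, hsnd⟩ := exists_nonneg_combination_eq_zero t I hgordan
    have hIeq : ∀ i, 0 < w i → r (t i) = (t i).1 * p.1 + (t i).2 * p.2 := by
      intro i hi
      have : i ∈ I := by
        by_contra h
        exact hi.ne' (hwI i h)
      simpa [I] using this
    apply HasScalarPlane.of_sub_scalar p.1 p.2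
    refine hasScalarPlane_of_balanced_triple (hA.sub_scalar p.1) (hB.sub_scalar p.2) hE (v := v)
      (fun h => by simp [h] at hv1) (t := t) (fun i h => ?_) hw hw1 hfst hsnd (fun i hi => ?_)
      (fun i => S (t i)) (fun i => (hS _).ge) (fun i hi u hu => ?_)
    · have := ht i
      simp [h] at this
    · have heq := hIeq i hi
      have h1 := hSeq (t i) v (hvS i) (by rw [hv1, heq]; ring)
      rw [heq] at h1
      push_cast at h1
      simp only [LinearMap.add_apply, LinearMap.sub_apply, LinearMap.smul_apply,
        LinearMap.id_apply] at h1 ⊢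
      linear_combination (norm := module) h1
    · have h1 := hSr (t i) u hu
      rw [hIeq i hi] at h1
      rw [quadValue_sub_scalar, quadValue_sub_scalar]
      linarith

end ScalarPlane

section Compression

variable {ι : Type*} [Fintype ι] [DecidableEq ι]

/-- On a subspace where the form of `T` is `c` times the squared norm, so is its sesquilinear
form. -/
theorem inner_eq_of_quadValue_eq {E : Type*} [NormedAddCommGroup E] [InnerProductSpace ℂ E]
    {T : E →ₗ[ℂ] E} (hT : T.IsSymmetric) {c : ℝ} {S : Submodule ℂ E}
    (h : ∀ u ∈ S, quadValue T u = c * ‖u‖ ^ 2) {u w : E} (hu : u ∈ S) (hw : w ∈ S) :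
    inner ℂ u (T w) = c * inner ℂ u w := by
  have h0 := inner_eq_zero_of_quadValue_eq_zero (hT.sub_scalar c)
    (fun v hv => by rw [quadValue_sub_scalar, h v hv, sub_self]) hu hw
  rw [LinearMap.sub_apply, LinearMap.smul_apply, LinearMap.id_apply, inner_sub_right,
    inner_smul_right] at h0
  exact sub_eq_zero.1 h0

open scoped ComplexOrder in
/-- A family of `k` orthonormal columns compressing `A` and `B` to scalars gives an anticlique. -/
theorem hasQuantumAnticlique_of_isometry {k : ℕ} (hk : 0 < k) {A B : Matrix ι ι ℂ}
    {V : Matrix ι (Fin k) ℂ} {c d : ℂ} (hV : Vᴴ * V = 1) (hA : Vᴴ * A * V = c • 1)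
    (hB : Vᴴ * B * V = d • 1) :
    HasQuantumAnticlique (Submodule.span ℂ {(1 : Matrix ι ι ℂ), A, B}) k := by
  have hrank : (V * Vᴴ).rank = k := by
    rw [Matrix.rank_self_mul_conjTranspose, ← Matrix.rank_conjTranspose_mul_self, hV,
      Matrix.rank_one, Fintype.card_fin]
  have hcomp : ∀ {X : Matrix ι ι ℂ} {c : ℂ}, Vᴴ * X * V = c • 1 →
      V * Vᴴ * (X * (V * Vᴴ)) = c • (V * Vᴴ) := by
    intro X c hX
    calc V * Vᴴ * (X * (V * Vᴴ)) = V * (Vᴴ * X * V) * Vᴴ := by simp only [Matrix.mul_assoc]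
      _ = _ := by rw [hX]; simp
  have hPP : V * Vᴴ * (V * Vᴴ) = V * Vᴴ := by
    simpa using hcomp (X := 1) (c := 1) (by simpa using hV)
  refine ⟨V * Vᴴ, ⟨hPP, by simp⟩, hrank, ?_⟩
  have hP0 : V * Vᴴ ≠ 0 := by
    intro h
    rw [h, Matrix.rank_zero] at hrank
    omega
  have hspan : compress (V * Vᴴ) (Submodule.span ℂ {(1 : Matrix ι ι ℂ), A, B}) =
      Submodule.span ℂ {V * Vᴴ} := by
    rw [compress, Submodule.map_span]
    apply le_antisymm <;> rw [Submodule.span_le]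
    · rintro _ ⟨X, rfl | rfl | rfl, rfl⟩
      · simp [hPP]
      · simp only [LinearMap.comp_apply, LinearMap.mulRight_apply, LinearMap.mulLeft_apply,
          hcomp hA]
        exact Submodule.smul_mem _ _ (Submodule.mem_span_singleton_self _)
      · simp only [LinearMap.comp_apply, LinearMap.mulRight_apply, LinearMap.mulLeft_apply,
          hcomp hB]
        exact Submodule.smul_mem _ _ (Submodule.mem_span_singleton_self _)
    · rintro _ rfl
      exact Submodule.subset_span ⟨1, by simp, by simp [hPP]⟩
  rw [hspan, finrank_span_singleton hP0]

end Compression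

/-- A matrix with orthonormal columns spanning a scalar plane. -/
theorem exists_isometry_of_hasScalarPlane {n : ℕ} {A B : Matrix (Fin n) (Fin n) ℂ}
    (hA : A.IsHermitian) (hB : B.IsHermitian)
    (h : HasScalarPlane (Matrix.toEuclideanLin A) (Matrix.toEuclideanLin B)) :
    ∃ (V : Matrix (Fin n) (Fin 2) ℂ) (c d : ℂ),
      Vᴴ * V = 1 ∧ Vᴴ * A * V = c • 1 ∧ Vᴴ * B * V = d • 1 := by
  obtain ⟨c, d, S, hS, hq⟩ := h
  let e := stdOrthonormalBasis ℂ S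
  let f : Fin 2 → EuclideanSpace ℂ (Fin n) := fun i => e (Fin.castLE hS i)
  have hfS : ∀ i, f i ∈ S := fun i => (e (Fin.castLE hS i)).2
  have hf : ∀ i j, inner ℂ (f i) (f j) = if i = j then (1 : ℂ) else 0 := by
    intro i j
    have := orthonormal_iff_ite.1 e.orthonormal (Fin.castLE hS i) (Fin.castLE hS j)
    simpa [f] using this
  let V : Matrix (Fin n) (Fin 2) ℂ := Matrix.of fun x i => f i x
  have hentry : ∀ (X : Matrix (Fin n) (Fin n) ℂ) i j,
      (Vᴴ * X * V) i j = inner ℂ (f i) (Matrix.toEuclideanLin X (f j)) := by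
    intro X i j
    rw [Matrix.mul_assoc]
    simp [Matrix.mul_apply, V, PiLp.inner_apply, Matrix.toLpLin_apply, Matrix.mulVec,
      dotProduct, mul_comm]
  have hscalar : ∀ {X : Matrix (Fin n) (Fin n) ℂ} {a : ℝ}, X.IsHermitian →
      (∀ u ∈ S, quadValue (Matrix.toEuclideanLin X) u = a * ‖u‖ ^ 2) →
      Vᴴ * X * V = (a : ℂ) • 1 := by
    intro X a hX ha
    ext i j
    rw [hentry, inner_eq_of_quadValue_eq (Matrix.isSymmetric_toEuclideanLin_iff.2 hX) ha (hfS i)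
      (hfS j), hf]
    simp [Matrix.one_apply]
  refine ⟨V, c, d, ?_, hscalar hA fun u hu => (hq u hu).1, hscalar hB fun u hu => (hq u hu).2⟩
  ext i j
  have := hentry 1 i j
  rw [Matrix.mul_one] at this
  rw [this, Matrix.one_apply, ← hf]
  simp

theorem stmt_12 (A B : Matrix (Fin 4) (Fin 4) ℂ) (hA : Aᴴ = A) (hB : Bᴴ = B)
    (hrep : ∃ μ : ℝ,
      2 ≤ Module.finrank ℂ (LinearMap.ker (A - (μ : ℂ) • 1).mulVecLin)) :
    HasQuantumAnticlique
      (Submodule.span ℂ {(1 : Matrix (Fin 4) (Fin 4) ℂ), A, B}) 2 := by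
  obtain ⟨V, c, d, hV, hVA, hVB⟩ := exists_isometry_of_hasScalarPlane hA hB
    (hasScalarPlane_of_finrank_eq_four (Matrix.isSymmetric_toEuclideanLin_iff.2 hA)
      (Matrix.isSymmetric_toEuclideanLin_iff.2 hB) (by simp))
  exact hasQuantumAnticlique_of_isometry two_pos hV hVA hVB
end

section
/- Let Q₁, Q₂, Q₃ be orthogonal projections in M₆(ℂ), each of rank 2, satisfying Q₁ + Q₂ + Q₃ = I₆. Then every operator system properly contained in span_ℂ(Q₁, Q₂, Q₃) has a quantum 4-anticlique. -/
open Matrix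

theorem IsOrthogonalProjection.trace_eq_rank {ι : Type*} [Fintype ι] [DecidableEq ι]
    {P : Matrix ι ι ℂ} (hP : IsOrthogonalProjection P) : P.trace = P.rank := by
  have hproj : LinearMap.IsProj (LinearMap.range P.toLin') P.toLin' :=
    LinearMap.isProj_range_iff_isIdempotentElem _ |>.mpr <| by
      rw [IsIdempotentElem, Module.End.mul_eq_comp, ← Matrix.toLin'_mul, hP.1]
  have := hproj.trace
  rwa [Matrix.trace_toLin'_eq] at this

open scoped ComplexOrder in
/-- Orthogonal projections summing to the identity are mutually orthogonal. -/
theorem IsOrthogonalProjection.mul_eq_zero_of_add_eq_one {ι : Type*} [Fintype ι] [DecidableEq ι]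
    {P Q R : Matrix ι ι ℂ} (hP : IsOrthogonalProjection P) (hQ : IsOrthogonalProjection Q)
    (hR : IsOrthogonalProjection R) (hsum : P + Q + R = 1) : Q * P = 0 := by
  have h : (Q * P)ᴴ * (Q * P) + (R * P)ᴴ * (R * P) = 0 := by
    have e : ∀ S : Matrix ι ι ℂ, IsOrthogonalProjection S → (S * P)ᴴ * (S * P) = P * S * P := by
      intro S hS
      rw [conjTranspose_mul, hS.2, hP.2, Matrix.mul_assoc, ← Matrix.mul_assoc S S, hS.1,
        Matrix.mul_assoc]
    rw [e Q hQ, e R hR, ← Matrix.add_mul, ← Matrix.mul_add,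
      show Q + R = 1 - P by rw [← hsum]; abel]
    rw [Matrix.mul_sub, hP.1, Matrix.mul_one, sub_self, Matrix.zero_mul]
  have ht := congrArg Matrix.trace h
  rw [Matrix.trace_add, Matrix.trace_zero] at ht
  have h1 := (posSemidef_conjTranspose_mul_self (Q * P)).trace_nonneg
  have h2 := (posSemidef_conjTranspose_mul_self (R * P)).trace_nonneg
  exact trace_conjTranspose_mul_self_eq_zero_iff.mp ((add_eq_zero_iff_of_nonneg h1 h2).mp ht).1

/-- The range of an orthogonal projection of rank `k` contains `k` orthonormal vectors. -/
theorem IsOrthogonalProjection.exists_isometry {ι : Type*} [Fintype ι] [DecidableEq ι]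
    {P : Matrix ι ι ℂ} (hP : IsOrthogonalProjection P) {k : ℕ} (hk : P.rank = k) :
    ∃ B : Matrix ι (Fin k) ℂ, Bᴴ * B = 1 ∧ P * B = B := by
  let S := LinearMap.range P.toEuclideanLin
  have hS : Module.finrank ℂ S = k := by
    rw [← hk, Matrix.rank_eq_finrank_range_toLin P
      (EuclideanSpace.basisFun ι ℂ).toBasis (EuclideanSpace.basisFun ι ℂ).toBasis,
      ← Matrix.toEuclideanLin_eq_toLin_orthonormal]
  let b := (stdOrthonormalBasis ℂ S).reindex (finCongr hS)
  refine ⟨Matrix.of fun i j => (b j : EuclideanSpace ℂ ι) i, ?_, ?_⟩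
  · ext i j
    have := orthonormal_iff_ite.mp b.orthonormal i j
    rw [Submodule.coe_inner, EuclideanSpace.inner_eq_star_dotProduct] at this
    rw [Matrix.one_apply, ← this, Matrix.mul_apply, dotProduct]
    simp [mul_comm]
  · ext i j
    obtain ⟨v, hv⟩ := (b j).2
    have : P *ᵥ (b j : EuclideanSpace ℂ ι).ofLp = (b j : EuclideanSpace ℂ ι).ofLp := by
      rw [← hv, Matrix.ofLp_toLpLin, Matrix.toLin'_apply, Matrix.mulVec_mulVec, hP.1]
    exact congrFun this i

/-- If the coefficients of all elements of `V` satisfy `y = c² x + s² z`, then a rotation of the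
range of `P` towards that of `R`, together with the range of `Q`, is an anticlique. -/
theorem hasQuantumAnticlique_of_convex_combination {ι : Type*} [Fintype ι] [DecidableEq ι]
    {P Q R : Matrix ι ι ℂ} (hP : IsOrthogonalProjection P) (hQ : IsOrthogonalProjection Q)
    (hR : IsOrthogonalProjection R) (hsum : P + Q + R = 1) {k l : ℕ} (hk : 0 < k)
    (hPk : P.rank = k) (hRk : R.rank = k) (hQl : Q.rank = l)
    {V : Submodule ℂ (Matrix ι ι ℂ)} (hV : 1 ∈ V) {c s : ℝ} (hcs : c ^ 2 + s ^ 2 = 1)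
    (hmem : ∀ A ∈ V, ∃ x y z : ℂ, A = x • P + y • Q + z • R ∧ y = c ^ 2 * x + s ^ 2 * z) :
    HasQuantumAnticlique V (l + k) := by
  have hQP : Q * P = 0 := hP.mul_eq_zero_of_add_eq_one hQ hR hsum
  have hQR : Q * R = 0 := hR.mul_eq_zero_of_add_eq_one hQ hP (by rw [← hsum]; abel)
  have hRP : R * P = 0 := hP.mul_eq_zero_of_add_eq_one hR hQ (by rw [← hsum]; abel)
  have hPR : P * R = 0 := hR.mul_eq_zero_of_add_eq_one hP hQ (by rw [← hsum]; abel)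
  have hPQ : P * Q = 0 := hQ.mul_eq_zero_of_add_eq_one hP hR (by rw [← hsum]; abel)
  have hRQ : R * Q = 0 := hQ.mul_eq_zero_of_add_eq_one hR hP (by rw [← hsum]; abel)
  obtain ⟨B, hB, hPB⟩ := hP.exists_isometry hPk
  obtain ⟨D, hD, hRD⟩ := hR.exists_isometry hRk
  have hcs' : (c : ℂ) ^ 2 + (s : ℂ) ^ 2 = 1 := by exact_mod_cast hcs
  have hQB : Q * B = 0 := by rw [← hPB, ← Matrix.mul_assoc, hQP, Matrix.zero_mul]
  have hRB : R * B = 0 := by rw [← hPB, ← Matrix.mul_assoc, hRP, Matrix.zero_mul]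
  have hQD : Q * D = 0 := by rw [← hRD, ← Matrix.mul_assoc, hQR, Matrix.zero_mul]
  have hPD : P * D = 0 := by rw [← hRD, ← Matrix.mul_assoc, hPR, Matrix.zero_mul]
  have hBD : Bᴴ * D = 0 := by
    rw [← hPB, conjTranspose_mul, hP.2, Matrix.mul_assoc, hPD, Matrix.mul_zero]
  have hDB : Dᴴ * B = 0 := by
    rw [← hRD, conjTranspose_mul, hR.2, Matrix.mul_assoc, hRB, Matrix.mul_zero]
  obtain ⟨C, hC⟩ : ∃ C, C = (c : ℂ) • B + (s : ℂ) • D := ⟨_, rfl⟩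
  have hCH : Cᴴ = (c : ℂ) • Bᴴ + (s : ℂ) • Dᴴ := by simp [hC]
  have hPC : P * C = (c : ℂ) • B := by simp [hC, Matrix.mul_add, hPB, hPD]
  have hRC : R * C = (s : ℂ) • D := by simp [hC, Matrix.mul_add, hRB, hRD]
  have hQC : Q * C = 0 := by simp [hC, Matrix.mul_add, hQB, hQD]
  have hCQ : Cᴴ * Q = 0 := by
    have := congrArg conjTranspose hQC
    rwa [conjTranspose_mul, hQ.2, conjTranspose_zero] at this
  have hCB : Cᴴ * B = (c : ℂ) • 1 := by simp [hCH, Matrix.add_mul, hB, hDB]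
  have hCD : Cᴴ * D = (s : ℂ) • 1 := by simp [hCH, Matrix.add_mul, hD, hBD]
  have hCC : Cᴴ * C = 1 := by
    rw [hC, Matrix.mul_add, ← hC, Matrix.mul_smul, Matrix.mul_smul, hCB, hCD, smul_smul, smul_smul,
      ← add_smul, ← sq, ← sq, hcs', one_smul]
  have hE : IsOrthogonalProjection (Q + C * Cᴴ) := by
    refine ⟨?_, by simp [hQ.2]⟩
    rw [Matrix.add_mul, Matrix.mul_add, Matrix.mul_add, hQ.1, ← Matrix.mul_assoc Q, hQC,
      Matrix.mul_assoc C, hCQ, Matrix.mul_assoc C, ← Matrix.mul_assoc Cᴴ, hCC]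
    simp
  have hrank : (Q + C * Cᴴ).rank = l + k := by
    have h := hE.trace_eq_rank
    rw [Matrix.trace_add, Matrix.trace_mul_comm C, hCC, hQ.trace_eq_rank, hQl] at h
    simp only [Matrix.trace_one, Fintype.card_fin] at h
    exact_mod_cast h.symm
  refine ⟨Q + C * Cᴴ, hE, hrank, ?_⟩
  generalize hEdef : Q + C * Cᴴ = E at hE hrank ⊢
  have hE0 : E ≠ 0 := by
    intro h
    rw [h, Matrix.rank_zero] at hrank
    omega
  have hEQ : E * Q * E = Q := by
    rw [← hEdef, Matrix.add_mul Q, hQ.1, Matrix.mul_assoc C, hCQ, Matrix.mul_zero, add_zero,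
      Matrix.mul_add, hQ.1, ← Matrix.mul_assoc, hQC, Matrix.zero_mul, add_zero]
  have hEP : E * P * E = (c : ℂ) ^ 2 • (C * Cᴴ) := by
    rw [← hEdef, Matrix.add_mul Q, hQP, zero_add, Matrix.mul_add, Matrix.mul_assoc _ P Q, hPQ,
      Matrix.mul_zero, zero_add, Matrix.mul_assoc _ P, ← Matrix.mul_assoc P, hPC,
      Matrix.mul_assoc C, ← Matrix.mul_assoc Cᴴ, Matrix.mul_smul, hCB, smul_smul, ← sq]
    simp
  have hER : E * R * E = (s : ℂ) ^ 2 • (C * Cᴴ) := by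
    rw [← hEdef, Matrix.add_mul Q, hQR, zero_add, Matrix.mul_add, Matrix.mul_assoc _ R Q, hRQ,
      Matrix.mul_zero, zero_add, Matrix.mul_assoc _ R, ← Matrix.mul_assoc R, hRC,
      Matrix.mul_assoc C, ← Matrix.mul_assoc Cᴴ, Matrix.mul_smul, hCD, smul_smul, ← sq]
    simp
  have hcompress : compress E V = ℂ ∙ E := by
    apply le_antisymm
    · rintro _ ⟨A, hA, rfl⟩
      obtain ⟨x, y, z, rfl, hy⟩ := hmem A hA
      refine Submodule.mem_span_singleton.mpr ⟨y, ?_⟩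
      change y • E = E * ((x • P + y • Q + z • R) * E)
      rw [← Matrix.mul_assoc, Matrix.mul_add, Matrix.mul_add, Matrix.add_mul, Matrix.add_mul]
      simp only [Matrix.mul_smul, Matrix.smul_mul, hEQ, hEP, hER]
      rw [← hEdef, hy]
      module
    · rw [Submodule.span_singleton_le_iff_mem]
      refine ⟨1, hV, ?_⟩
      change E * (1 * E) = E
      rw [Matrix.one_mul, hE.1]
  rw [hcompress, finrank_span_singleton hE0]

/-- A subspace of `ℂ^ι`, proper and closed under conjugation, is annihilated by a nonzero real
functional. -/
theorem exists_real_annihilator {ι : Type*} [Fintype ι] [DecidableEq ι]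
    {T : Submodule ℂ (ι → ℂ)} (hT : T < ⊤) (hstar : ∀ x ∈ T, star x ∈ T) :
    ∃ r : ι → ℝ, r ≠ 0 ∧ ∀ x ∈ T, ∑ i, (r i : ℂ) * x i = 0 := by
  obtain ⟨f, hf, hTf⟩ := T.exists_le_ker_of_lt_top hT
  let a : ι → ℂ := fun i => f (Pi.single i 1)
  have hfa : ∀ x, f x = ∑ i, a i * x i := by
    intro x
    rw [LinearMap.pi_apply_eq_sum_univ f x]
    refine Finset.sum_congr rfl fun i _ => ?_
    rw [smul_eq_mul, mul_comm]
    congr 2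
    ext j
    simp [Pi.single_apply, eq_comm]
  have h1 : ∀ x ∈ T, ∑ i, a i * x i = 0 := fun x hx => by rw [← hfa]; exact hTf hx
  have h2 : ∀ x ∈ T, ∑ i, star (a i) * x i = 0 := fun x hx => by
    simpa [star_sum] using congrArg star (h1 _ (hstar x hx))
  have hre : ∀ x ∈ T, ∑ i, ((a i).re : ℂ) * x i = 0 := fun x hx => by
    have : ∀ i, ((a i).re : ℂ) * x i = (a i * x i + star (a i) * x i) / 2 := fun i => by
      rw [Complex.re_eq_add_conj, Complex.star_def]; ring
    rw [Finset.sum_congr rfl fun i _ => this i, ← Finset.sum_div, Finset.sum_add_distrib, h1 x hx,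
      h2 x hx, add_zero, zero_div]
  have him : ∀ x ∈ T, ∑ i, ((a i).im : ℂ) * x i = 0 := fun x hx => by
    have : ∀ i, ((a i).im : ℂ) * x i = (a i * x i - star (a i) * x i) / (2 * Complex.I) :=
      fun i => by rw [Complex.im_eq_sub_conj, Complex.star_def]; ring
    rw [Finset.sum_congr rfl fun i _ => this i, ← Finset.sum_div, Finset.sum_sub_distrib, h1 x hx,
      h2 x hx, sub_zero, zero_div]
  by_cases h : (fun i => (a i).re) = 0
  · refine ⟨fun i => (a i).im, fun h' => hf ?_, him⟩
    ext i
    exact Complex.ext (congrFun h i) (congrFun h' i)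
  · exact ⟨_, h, hre⟩

/-- A nontrivial real relation between three numbers whose coefficients sum to zero expresses one
of the numbers as a convex combination of the others. -/
theorem exists_convex_coefficients {r : Fin 3 → ℝ} (hr : r ≠ 0) (hsum : ∑ i, r i = 0) :
    ∃ σ : Equiv.Perm (Fin 3), ∃ c s : ℝ, c ^ 2 + s ^ 2 = 1 ∧ r (σ 1) ≠ 0 ∧
      r (σ 0) = -(c ^ 2 * r (σ 1)) ∧ r (σ 2) = -(s ^ 2 * r (σ 1)) := by
  have key : ∀ σ : Equiv.Perm (Fin 3), 0 ≤ r (σ 0) * r (σ 2) →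
      ∃ σ : Equiv.Perm (Fin 3), ∃ c s : ℝ, c ^ 2 + s ^ 2 = 1 ∧ r (σ 1) ≠ 0 ∧
      r (σ 0) = -(c ^ 2 * r (σ 1)) ∧ r (σ 2) = -(s ^ 2 * r (σ 1)) := by
    intro σ h
    have hs : r (σ 0) + r (σ 1) + r (σ 2) = 0 := by
      rw [← Fin.sum_univ_three (fun i => r (σ i)), Equiv.sum_comp σ r, hsum]
    have h1 : r (σ 1) ≠ 0 := by
      intro h1
      have h0 : r (σ 0) = 0 := by nlinarith
      have h2 : r (σ 2) = 0 := by linarith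
      refine hr (funext fun i => ?_)
      obtain ⟨j, rfl⟩ := σ.surjective i
      fin_cases j
      exacts [h0, h1, h2]
    have hs0 : r (σ 0) * (r (σ 0) + r (σ 1) + r (σ 2)) = 0 := by rw [hs, mul_zero]
    have hs2 : r (σ 2) * (r (σ 0) + r (σ 1) + r (σ 2)) = 0 := by rw [hs, mul_zero]
    have hsq : 0 < r (σ 1) ^ 2 := by positivity
    have hc : 0 ≤ -r (σ 0) / r (σ 1) := by
      rw [show -r (σ 0) / r (σ 1) = (-r (σ 0) * r (σ 1)) / r (σ 1) ^ 2 by field_simp]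
      refine div_nonneg ?_ hsq.le
      nlinarith only [sq_nonneg (r (σ 0)), h, hs0]
    have hs' : 0 ≤ -r (σ 2) / r (σ 1) := by
      rw [show -r (σ 2) / r (σ 1) = (-r (σ 2) * r (σ 1)) / r (σ 1) ^ 2 by field_simp]
      refine div_nonneg ?_ hsq.le
      nlinarith only [sq_nonneg (r (σ 2)), h, hs2]
    refine ⟨σ, √(-r (σ 0) / r (σ 1)), √(-r (σ 2) / r (σ 1)), ?_, h1, ?_, ?_⟩
    · rw [Real.sq_sqrt hc, Real.sq_sqrt hs']
      field_simp
      linarith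
    · rw [Real.sq_sqrt hc]
      field_simp
    · rw [Real.sq_sqrt hs']
      field_simp
  rcases le_or_gt 0 (r 0 * r 2) with h | h
  · exact key 1 h
  rcases le_or_gt 0 (r 0 * r 1) with h' | h'
  · exact key (Equiv.swap 1 2) (by simpa [Equiv.swap_apply_of_ne_of_ne] using h')
  · refine key (Equiv.swap 0 1) ?_
    have h3 : 0 ≤ r 1 * r 2 := by
      by_contra! h3
      nlinarith [mul_pos_of_neg_of_neg h h', mul_nonneg_of_nonpos_of_nonpos 
        (neg_nonpos.mpr (sq_nonneg (r 0))) h3.le]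
    simpa [Equiv.swap_apply_of_ne_of_ne] using h3

theorem stmt_13 (Q : Fin 3 → Matrix (Fin 6) (Fin 6) ℂ)
    (hproj : ∀ i, IsOrthogonalProjection (Q i))
    (hrank : ∀ i, (Q i).rank = 2)
    (hsum : ∑ i, Q i = 1)
    (V₀ : Submodule ℂ (Matrix (Fin 6) (Fin 6) ℂ))
    (hV₀ : IsOperatorSystem V₀)
    (hlt : V₀ < Submodule.span ℂ (Set.range Q)) :
    HasQuantumAnticlique V₀ 4 := by
  let T : Submodule ℂ (Fin 3 → ℂ) := V₀.comap (Fintype.linearCombination ℂ Q)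
  have hT : T < ⊤ := by
    rw [lt_top_iff_ne_top]
    intro h
    refine hlt.not_ge ?_
    rw [← Fintype.range_linearCombination, LinearMap.range_le_iff_comap]
    exact h
  have hstar : ∀ x ∈ T, star x ∈ T := by
    intro x hx
    have := hV₀.2 _ hx
    rw [Fintype.linearCombination_apply, conjTranspose_sum] at this
    simp only [conjTranspose_smul, (hproj _).2] at this
    exact this
  obtain ⟨r, hr, hrT⟩ := exists_real_annihilator hT hstar
  have hr0 : ∑ i, r i = 0 := by
    have h1 : (1 : Fin 3 → ℂ) ∈ T := by
      change Fintype.linearCombination ℂ Q 1 ∈ V₀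
      simpa [Fintype.linearCombination_apply, hsum] using hV₀.1
    have := hrT 1 h1
    simp only [Pi.one_apply, mul_one] at this
    exact_mod_cast this
  obtain ⟨σ, c, s, hcs, h1, h0, h2⟩ := exists_convex_coefficients hr hr0
  refine hasQuantumAnticlique_of_convex_combination (k := 2) (l := 2) (hproj (σ 0)) (hproj (σ 1))
    (hproj (σ 2)) ?_ two_pos (hrank _) (hrank _) (hrank _) hV₀.1 hcs fun A hA => ?_
  · rw [← Fin.sum_univ_three (fun i => Q (σ i)), Equiv.sum_comp σ Q, hsum]
  · have hA' := hlt.le hA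
    rw [← Fintype.range_linearCombination] at hA'
    obtain ⟨x, rfl⟩ := hA'
    refine ⟨x (σ 0), x (σ 1), x (σ 2), ?_, ?_⟩
    · rw [← Fin.sum_univ_three (fun i => x (σ i) • Q (σ i)),
        Equiv.sum_comp σ (fun i => x i • Q i), Fintype.linearCombination_apply]
    · have := hrT x hA
      rw [← Equiv.sum_comp σ, Fin.sum_univ_three, h0, h2] at this
      have h1' : (r (σ 1) : ℂ) ≠ 0 := by exact_mod_cast h1
      apply mul_left_cancel₀ h1'
      push_cast at this
      linear_combination this
end

section
/- Let 1 ≤ k ≤ n and let Q be an orthogonal projection in M_n(ℂ) of rank n − k + 1. Define the operator system 𝒱_Q = {A ∈ M_n(ℂ) : QAQ is a scalar multiple of Q}. Then every operator system 𝒱' with 𝒱_Q ⊆ 𝒱' and dim(𝒱') ≤ dim(𝒱_Q) + 2 has no quantum (k+1)-clique. In particular, 𝒱_Q itself has no quantum (k+1)-clique. -/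
open Matrix

/-- The operator system `V_Q = {A : QAQ is a scalar multiple of Q}`. -/
noncomputable def VQ {n : ℕ} (Q : Matrix (Fin n) (Fin n) ℂ) :
    Submodule ℂ (Matrix (Fin n) (Fin n) ℂ) :=
  (Submodule.span ℂ {Q}).comap
    ((LinearMap.mulLeft ℂ Q).comp (LinearMap.mulRight ℂ Q))


/-- A matrix of rank `r` factors through an `r`-dimensional space. -/
lemma Matrix.exists_eq_mul_of_rank_eq {m n : Type*} [Fintype m] [Fintype n] [DecidableEq n]
    {P : Matrix m n ℂ} {r : ℕ} (hr : P.rank = r) :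
    ∃ (X : Matrix m (Fin r) ℂ) (Y : Matrix (Fin r) n ℂ), P = X * Y := by
  let b := (Module.finBasisOfFinrankEq ℂ P.mulVecLin.range hr).equivFun
  refine ⟨LinearMap.toMatrix' (P.mulVecLin.range.subtype ∘ₗ b.symm.toLinearMap),
    LinearMap.toMatrix' (b.toLinearMap ∘ₗ P.mulVecLin.rangeRestrict), ?_⟩
  rw [← LinearMap.toMatrix'_comp]
  apply Matrix.toLin'.injective
  rw [Matrix.toLin'_toMatrix']
  ext x
  simp

/-- The corner `P M P` of a matrix of rank `r` has dimension at most `r ^ 2`. -/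
lemma finrank_compress_top_le {ι : Type*} [Fintype ι] [DecidableEq ι] (P : Matrix ι ι ℂ) :
    Module.finrank ℂ (compress P ⊤) ≤ P.rank ^ 2 := by
  obtain ⟨X, Y, hXY⟩ := Matrix.exists_eq_mul_of_rank_eq (P := P) rfl
  let S : Matrix (Fin P.rank) (Fin P.rank) ℂ →ₗ[ℂ] Matrix ι ι ℂ :=
    { toFun := fun B => X * B * Y
      map_add' := by intros; simp [Matrix.mul_add, Matrix.add_mul]
      map_smul' := by intros; simp }
  have hle : compress P ⊤ ≤ LinearMap.range S := by
    rintro _ ⟨A, -, rfl⟩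
    refine ⟨Y * A * X, ?_⟩
    change X * (Y * A * X) * Y = P * (A * P)
    conv_rhs => rw [hXY]
    simp only [Matrix.mul_assoc]
  calc Module.finrank ℂ (compress P ⊤) ≤ Module.finrank ℂ (LinearMap.range S) :=
        Submodule.finrank_mono hle
    _ ≤ Module.finrank ℂ (Matrix (Fin P.rank) (Fin P.rank) ℂ) := LinearMap.finrank_range_le S
    _ = P.rank ^ 2 := by simp [Module.finrank_matrix, sq]

/-- Two idempotents whose ranks add up to at least `n + d` fix a common `d`-dimensional space,
presented by a matrix with a left inverse. -/
lemma exists_left_invertible_fixed {ι : Type*} [Fintype ι] [DecidableEq ι] {P Q : Matrix ι ι ℂ}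
    (hP : P * P = P) (hQ : Q * Q = Q) {d : ℕ} (h : Fintype.card ι + d ≤ P.rank + Q.rank) :
    ∃ (U : Matrix ι (Fin d) ℂ) (L : Matrix (Fin d) ι ℂ), L * U = 1 ∧ P * U = U ∧ Q * U = U := by
  let W := P.mulVecLin.range ⊓ Q.mulVecLin.range
  have hW : d ≤ Module.finrank ℂ W := by
    have h1 := Submodule.finrank_sup_add_finrank_inf_eq P.mulVecLin.range Q.mulVecLin.range
    have h2 := Submodule.finrank_le (P.mulVecLin.range ⊔ Q.mulVecLin.range)
    rw [Module.finrank_fintype_fun_eq_card] at h2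
    unfold Matrix.rank at h
    change d ≤ Module.finrank ℂ ↥(P.mulVecLin.range ⊓ Q.mulVecLin.range)
    omega
  obtain ⟨f, hf⟩ := exists_linearIndependent_of_le_finrank hW
  let g := W.subtype ∘ₗ Fintype.linearCombination ℂ f
  have hg : Function.Injective g :=
    W.injective_subtype.comp hf.fintypeLinearCombination_injective
  obtain ⟨l, hl⟩ := g.exists_leftInverse_of_injective (LinearMap.ker_eq_bot.mpr hg)
  have fix : ∀ R : Matrix ι ι ℂ, R * R = R → W ≤ R.mulVecLin.range →
      R * LinearMap.toMatrix' g = LinearMap.toMatrix' g := by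
    intro R hR hWR
    apply Matrix.toLin'.injective
    ext1 i
    ext1
    simp only [Matrix.toLin'_mul, Matrix.toLin'_toMatrix', LinearMap.comp_apply]
    obtain ⟨y, hy⟩ := hWR (Fintype.linearCombination ℂ f (Pi.single i 1)).2
    change R *ᵥ y = g (Pi.single i 1) at hy
    simp [← hy, Matrix.mulVec_mulVec, hR]
  refine ⟨LinearMap.toMatrix' g, LinearMap.toMatrix' l, ?_, fix P hP inf_le_left,
    fix Q hQ inf_le_right⟩
  rw [← LinearMap.toMatrix'_comp, hl, LinearMap.toMatrix'_id]

/-- Enlarging a subspace by at most `d` dimensions enlarges its images by at most `d`. -/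
lemma finrank_map_le_of_finrank_le_add {K M N : Type*} [Field K] [AddCommGroup M] [Module K M]
    [FiniteDimensional K M] [AddCommGroup N] [Module K N] (f : M →ₗ[K] N)
    {V W : Submodule K M} (hle : V ≤ W) {d : ℕ}
    (h : Module.finrank K W ≤ Module.finrank K V + d) :
    Module.finrank K (W.map f) ≤ Module.finrank K (V.map f) + d := by
  obtain ⟨T, hdisj, rfl⟩ := IsModularLattice.exists_disjoint_and_sup_eq hle
  have h1 := Submodule.finrank_sup_add_finrank_inf_eq V T
  rw [hdisj.eq_bot, finrank_bot] at h1
  rw [Submodule.map_sup]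
  have h2 := Submodule.finrank_add_le_finrank_add_finrank (V.map f) (T.map f)
  have h3 := Submodule.finrank_map_le f T
  omega

theorem stmt_14 (n k : ℕ) (hk : 1 ≤ k) (hkn : k ≤ n)
    (Q : Matrix (Fin n) (Fin n) ℂ)
    (hQ : IsOrthogonalProjection Q) (hQrank : Q.rank = n - k + 1)
    (V' : Submodule ℂ (Matrix (Fin n) (Fin n) ℂ))
    (hV' : IsOperatorSystem V')
    (hle : VQ Q ≤ V')
    (hdim : Module.finrank ℂ V' ≤ Module.finrank ℂ (VQ Q) + 2) :
    ¬ HasQuantumClique V' (k + 1) := by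
  rintro ⟨P, hP, hPrank, hclique⟩
  have hfull : compress P V' = compress P ⊤ :=
    Submodule.eq_of_le_of_finrank_le (Submodule.map_mono le_top)
      (by rw [hclique, ← hPrank]; exact finrank_compress_top_le P)
  obtain ⟨U, L, hLU, hPU, hQU⟩ := exists_left_invertible_fixed hP.1 hQ.1 (d := 2)
    (by rw [Fintype.card_fin]; omega)
  have adj : ∀ {R : Matrix (Fin n) (Fin n) ℂ}, Rᴴ = R → R * U = U → Uᴴ * R = Uᴴ := by
    intro R hR hRU
    rw [← hR, ← Matrix.conjTranspose_mul, hRU]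
  have sandwich : ∀ {R : Matrix (Fin n) (Fin n) ℂ}, Rᴴ = R → R * U = U →
      ∀ A, Uᴴ * (R * (A * R)) * U = Uᴴ * A * U := by
    intro R hR hRU A
    rw [← Matrix.mul_assoc, adj hR hRU, ← Matrix.mul_assoc, Matrix.mul_assoc _ R U, hRU]
  let F : Matrix (Fin n) (Fin n) ℂ →ₗ[ℂ] Matrix (Fin 2) (Fin 2) ℂ :=
    { toFun := fun A => Uᴴ * A * U
      map_add' := by intros; simp [Matrix.mul_add, Matrix.add_mul]
      map_smul' := by intros; simp }
  have hsurj : V'.map F = ⊤ := by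
    rw [eq_top_iff]
    intro B _
    have hmem : P * ((Lᴴ * B * L) * P) ∈ compress P V' := by
      rw [hfull]
      exact ⟨Lᴴ * B * L, trivial, rfl⟩
    obtain ⟨A, hA, hAB⟩ := hmem
    change P * (A * P) = _ at hAB
    refine ⟨A, hA, ?_⟩
    change Uᴴ * A * U = B
    have hUL : Uᴴ * Lᴴ = 1 := by rw [← Matrix.conjTranspose_mul, hLU, Matrix.conjTranspose_one]
    calc Uᴴ * A * U = Uᴴ * (Lᴴ * B * L) * U := by
          rw [← sandwich hP.2 hPU A, hAB, sandwich hP.2 hPU]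
      _ = (Uᴴ * Lᴴ) * B * (L * U) := by simp only [Matrix.mul_assoc]
      _ = B := by rw [hUL, hLU, Matrix.one_mul, Matrix.mul_one]
  have hone : Module.finrank ℂ ((VQ Q).map F) ≤ 1 := by
    have hsub : (VQ Q).map F ≤ Submodule.span ℂ {Uᴴ * U} := by
      rintro _ ⟨A, hA, rfl⟩
      obtain ⟨c, hc⟩ := Submodule.mem_span_singleton.mp hA
      change c • Q = Q * (A * Q) at hc
      refine Submodule.mem_span_singleton.mpr ⟨c, ?_⟩
      change c • (Uᴴ * U) = Uᴴ * A * U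
      rw [← sandwich hQ.2 hQU A, ← hc, Matrix.mul_smul, Matrix.smul_mul, adj hQ.2 hQU]
    exact (Submodule.finrank_mono hsub).trans ((finrank_span_le_card _).trans (by simp))
  have hfinal := finrank_map_le_of_finrank_le_add F hle hdim
  rw [hsurj, finrank_top, Module.finrank_matrix] at hfinal
  simp at hfinal
  omega
end

section
/- Let k ≥ 1 and let 𝒱₀ ⊂ M_{2k}(ℂ) be the set of block matrices of the form [[0, A], [B, 0]] with A, B ∈ M_k(ℂ) (zero k×k diagonal blocks). Then the operator system 𝒱 = 𝒱₀ + ℂ·I_{2k} has a quantum k-clique. -/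
open Matrix

/-- The linear map sending `D` to the block matrix all of whose four blocks are `D`. -/
def constBlocks (n : Type*) : Matrix n n ℂ →ₗ[ℂ] Matrix (n ⊕ n) (n ⊕ n) ℂ where
  toFun D := Matrix.fromBlocks D D D D
  map_add' D E := by rw [Matrix.fromBlocks_add]
  map_smul' c D := by rw [Matrix.fromBlocks_smul, RingHom.id_apply]

theorem constBlocks_apply {n : Type*} (D : Matrix n n ℂ) :
    constBlocks n D = Matrix.fromBlocks D D D D := rfl

theorem constBlocks_injective (n : Type*) : Function.Injective (constBlocks n) := by
  intro D E h
  rw [constBlocks_apply, constBlocks_apply, Matrix.fromBlocks_inj] at h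
  exact h.1

theorem isOrthogonalProjection_constBlocks (n : Type*) [Fintype n] [DecidableEq n] :
    IsOrthogonalProjection (constBlocks n ((1 / 2 : ℂ) • 1)) := by
  refine ⟨?_, ?_⟩
  · rw [constBlocks_apply, Matrix.fromBlocks_multiply]
    congr 1 <;> simp only [smul_mul_smul_comm, mul_one, ← add_smul] <;> norm_num
  · rw [constBlocks_apply, Matrix.fromBlocks_conjTranspose]
    congr 1 <;> simp [Matrix.conjTranspose_smul]

theorem rank_constBlocks (n : Type*) [Fintype n] [DecidableEq n] :
    (constBlocks n ((1 / 2 : ℂ) • 1)).rank = Fintype.card n := by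
  apply le_antisymm
  · have h : constBlocks n ((1 / 2 : ℂ) • 1) =
        Matrix.fromRows (1 : Matrix n n ℂ) 1 *
          Matrix.fromCols ((1 / 2 : ℂ) • (1 : Matrix n n ℂ)) ((1 / 2 : ℂ) • 1) := by
      rw [constBlocks_apply, Matrix.fromRows_mul_fromCols]
      simp
    rw [h]
    exact (Matrix.rank_mul_le_left _ _).trans (Matrix.rank_le_card_width _)
  · have h : Matrix.fromCols (1 : Matrix n n ℂ) (0 : Matrix n n ℂ) * constBlocks n ((1 / 2 : ℂ) • 1) *
        Matrix.fromRows ((2 : ℂ) • (1 : Matrix n n ℂ)) (0 : Matrix n n ℂ) = 1 := by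
      rw [constBlocks_apply, Matrix.fromCols_mul_fromBlocks, Matrix.fromCols_mul_fromRows]
      simp [smul_smul]
    rw [← Matrix.rank_one (R := ℂ) (n := n)]
    exact (congrArg Matrix.rank h).ge.trans
      ((Matrix.rank_mul_le_left _ _).trans (Matrix.rank_mul_le_right _ _))

theorem constBlocks_mul_fromBlocks_mul {n : Type*} [Fintype n] [DecidableEq n]
    (A B C D : Matrix n n ℂ) :
    constBlocks n ((1 / 2 : ℂ) • 1) * (Matrix.fromBlocks A B C D *
      constBlocks n ((1 / 2 : ℂ) • 1)) = constBlocks n ((1 / 4 : ℂ) • (A + B + C + D)) := by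
  simp only [constBlocks_apply, Matrix.fromBlocks_multiply, Matrix.smul_mul, Matrix.mul_smul,
    Matrix.one_mul, Matrix.mul_one]
  congr 1 <;> module

theorem compress_constBlocks_eq_range {n : Type*} [Fintype n] [DecidableEq n]
    (V : Submodule ℂ (Matrix (n ⊕ n) (n ⊕ n) ℂ))
    (hV : ∀ A : Matrix n n ℂ, Matrix.fromBlocks 0 A 0 0 ∈ V) :
    compress (constBlocks n ((1 / 2 : ℂ) • 1)) V = LinearMap.range (constBlocks n) := by
  apply le_antisymm
  · rintro _ ⟨M, -, rfl⟩
    rw [← Matrix.fromBlocks_toBlocks M]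
    exact ⟨_, (constBlocks_mul_fromBlocks_mul _ _ _ _).symm⟩
  · rintro _ ⟨D, rfl⟩
    refine ⟨Matrix.fromBlocks 0 ((4 : ℂ) • D) 0 0, hV _, ?_⟩
    refine (constBlocks_mul_fromBlocks_mul _ _ _ _).trans ?_
    simp [smul_smul]

theorem stmt_17 (k : ℕ) (hk : 1 ≤ k) :
    HasQuantumClique
      (Submodule.span ℂ
        (insert (1 : Matrix (Fin k ⊕ Fin k) (Fin k ⊕ Fin k) ℂ)
          {M : Matrix (Fin k ⊕ Fin k) (Fin k ⊕ Fin k) ℂ |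
            ∃ A B : Matrix (Fin k) (Fin k) ℂ, M = Matrix.fromBlocks 0 A B 0}))
      k := by
  refine ⟨constBlocks (Fin k) ((1 / 2 : ℂ) • 1), isOrthogonalProjection_constBlocks _, ?_, ?_⟩
  · rw [rank_constBlocks, Fintype.card_fin]
  · rw [compress_constBlocks_eq_range,
      LinearMap.finrank_range_of_inj (constBlocks_injective _), Module.finrank_matrix]
    · simp [sq]
    · exact fun A => Submodule.subset_span (Set.mem_insert_of_mem _ ⟨A, 0, rfl⟩)
end
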